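/- arXiv:1602.04017 — 3 statements merged into one kernel-verified Lean document; each statement's English description precedes it below -/
import Mathlib

section
/- Let α, β ≥ 0 and z ∈ 𝕋^{(d)}. Then the modified fractional power of the Hankel–Clifford transform J_{z,0} maps G_α(ℝ^d₊) onto G^α(ℝ^d₊), G^β(ℝ^d₊) onto G_β(ℝ^d₊), and G_α^β(ℝ^d₊) onto G_β^α(ℝ^d₊); in each case the map is a bijection whose inverse is J_{z̄,0}, i.e. for f in the source space J_{z,0} f lies in the target space and J_{z̄,0}(J_{z,0} f) = f. -/
open MeasureTheory Filter Finset

noncomputable section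

def Rpos (d : ℕ) : Set (Fin d → ℝ) := {x | ∀ i, 0 < x i}

def pd {d : ℕ} (i : Fin d) (f : (Fin d → ℝ) → ℂ) : (Fin d → ℝ) → ℂ :=
  fun x => fderiv ℝ f x (Pi.single i 1)

def mderiv {d : ℕ} (p : Fin d → ℕ) (f : (Fin d → ℝ) → ℂ) : (Fin d → ℝ) → ℂ :=
  ((List.ofFn fun i : Fin d => (fun g => (pd i)^[p i] g)).foldr (· ∘ ·) id) f

/-- The space `S(ℝ^d₊)`. -/
def IsSPlus {d : ℕ} (f : (Fin d → ℝ) → ℂ) : Prop :=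
  ContDiffOn ℝ (⊤ : ℕ∞) f (Rpos d) ∧
  (∀ p : Fin d → ℕ, ∃ g : (Fin d → ℝ) → ℂ,
    ContinuousOn g {x | ∀ i, 0 ≤ x i} ∧ ∀ x ∈ Rpos d, g x = mderiv p f x) ∧
  (∀ k p : Fin d → ℕ, ∃ C : ℝ, ∀ x ∈ Rpos d,
    (∏ i, x i ^ k i) * ‖mderiv p f x‖ ≤ C)

/-- The space `G_α^β(ℝ^d₊)`. -/
def IsGab {d : ℕ} (α β : ℝ) (f : (Fin d → ℝ) → ℂ) : Prop :=
  IsSPlus f ∧ ∃ A > (0:ℝ), ∃ C > (0:ℝ), ∀ p k : Fin d → ℕ,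
    Real.sqrt (∫ t in Rpos d, ((∏ i, t i ^ (((p i : ℝ) + (k i : ℝ))/2)) * ‖mderiv p f t‖)^2) ≤
      C * A ^ (∑ i, (p i + k i)) * (∏ i, ((k i : ℝ)) ^ ((α/2) * (k i : ℝ))) *
        (∏ i, ((p i : ℝ)) ^ ((β/2) * (p i : ℝ)))

/-- The space `G_α(ℝ^d₊)`. -/
def IsGlow {d : ℕ} (α : ℝ) (f : (Fin d → ℝ) → ℂ) : Prop :=
  IsSPlus f ∧ ∃ A > (0:ℝ), ∀ p : Fin d → ℕ, ∃ C : ℝ, ∀ k : Fin d → ℕ,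
    Real.sqrt (∫ t in Rpos d, ((∏ i, t i ^ (((p i : ℝ) + (k i : ℝ))/2)) * ‖mderiv p f t‖)^2) ≤
      C * A ^ (∑ i, k i) * (∏ i, ((k i : ℝ)) ^ ((α/2) * (k i : ℝ)))

/-- The space `G^β(ℝ^d₊)`. -/
def IsGupp {d : ℕ} (β : ℝ) (f : (Fin d → ℝ) → ℂ) : Prop :=
  IsSPlus f ∧ ∃ A > (0:ℝ), ∀ k : Fin d → ℕ, ∃ C : ℝ, ∀ p : Fin d → ℕ,
    Real.sqrt (∫ t in Rpos d, ((∏ i, t i ^ (((p i : ℝ) + (k i : ℝ))/2)) * ‖mderiv p f t‖)^2) ≤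
      C * A ^ (∑ i, p i) * (∏ i, ((p i : ℝ)) ^ ((β/2) * (p i : ℝ)))

/-- The entire function `K₀(u) = ∑ u^k/(k!)²`. -/
def K0 (u : ℂ) : ℂ := ∑' k : ℕ, u ^ k / ((k.factorial : ℂ))^2

/-- Modified fractional power of the Hankel-Clifford transform of order `0`. -/
def J0 {d : ℕ} (z : Fin d → ℂ) (f : (Fin d → ℝ) → ℂ) : (Fin d → ℝ) → ℂ :=
  fun t => (∏ l, (1 - z l)⁻¹) *
    ∫ x in Rpos d, f x * ∏ l, K0 ((x l : ℂ) * (t l : ℂ) * z l / (1 - z l)^2)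

section Families
variable {d : ℕ}

lemma isOpen_Rpos : IsOpen (Rpos d) := by
  have : Rpos d = ⋂ i, {x | 0 < x i} := by ext; simp [Rpos]
  rw [this]
  exact isOpen_iInter_of_finite fun i => isOpen_lt continuous_const (continuous_apply i)

lemma measurableSet_Rpos : MeasurableSet (Rpos d) := isOpen_Rpos.measurableSet

/-- The partial derivatives of each `G q` are the `G (q + e_i)`. -/
def IsFam (G : (Fin d → ℕ) → (Fin d → ℝ) → ℂ) : Prop :=
  ∀ q, ∀ x ∈ Rpos d, HasFDerivAt (G q) (∑ i,
    (ContinuousLinearMap.proj (R := ℝ) (φ := fun _ : Fin d => ℝ) i).smulRight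
      (G (q + Pi.single i 1) x)) x

/-- Every member of the family decays rapidly on the orthant. -/
def IsRapid (G : (Fin d → ℕ) → (Fin d → ℝ) → ℂ) : Prop :=
  ∀ k q : Fin d → ℕ, ∃ C : ℝ, ∀ x ∈ Rpos d, (∏ i, x i ^ k i) * ‖G q x‖ ≤ C

lemma sum_proj_smulRight_single (v : Fin d → ℂ) (i : Fin d) :
    (∑ j, (ContinuousLinearMap.proj (R := ℝ) (φ := fun _ : Fin d => ℝ) j).smulRight (v j))
      (Pi.single i 1) = v i := by
  simp [Pi.single_apply]

lemma eq_sum_proj_smulRight (L : (Fin d → ℝ) →L[ℝ] ℂ) :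
    L = ∑ j, (ContinuousLinearMap.proj (R := ℝ) (φ := fun _ : Fin d => ℝ) j).smulRight
      (L (Pi.single j 1)) := by
  ext x
  conv_lhs => rw [pi_eq_sum_univ' x]
  simp

lemma IsFam.pd_eq {G : (Fin d → ℕ) → (Fin d → ℝ) → ℂ} (hG : IsFam G) (q : Fin d → ℕ)
    (i : Fin d) {x : Fin d → ℝ} (hx : x ∈ Rpos d) : pd i (G q) x = G (q + Pi.single i 1) x := by
  rw [pd, (hG q x hx).fderiv]
  exact sum_proj_smulRight_single (fun j => G (q + Pi.single j 1) x) i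

lemma pd_congr {f g : (Fin d → ℝ) → ℂ} (h : Set.EqOn f g (Rpos d)) (i : Fin d) :
    Set.EqOn (pd i f) (pd i g) (Rpos d) := fun x hx => by
  rw [pd, pd, Filter.EventuallyEq.fderiv_eq (h.eventuallyEq_of_mem (isOpen_Rpos.mem_nhds hx))]

lemma iterate_pd_congr {f g : (Fin d → ℝ) → ℂ} (h : Set.EqOn f g (Rpos d)) (i : Fin d) (n : ℕ) :
    Set.EqOn ((pd i)^[n] f) ((pd i)^[n] g) (Rpos d) := by
  induction n generalizing f g with
  | zero => exact h
  | succ n ih => exact ih (pd_congr h i)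

/-- Iterated partial derivatives along the coordinates in a list. -/
def listDeriv (p : Fin d → ℕ) (L : List (Fin d)) (f : (Fin d → ℝ) → ℂ) : (Fin d → ℝ) → ℂ :=
  L.foldr (fun i g => (pd i)^[p i] g) f

lemma mderiv_eq_listDeriv (p : Fin d → ℕ) (f : (Fin d → ℝ) → ℂ) :
    mderiv p f = listDeriv p (List.finRange d) f := by
  unfold mderiv listDeriv
  rw [List.ofFn_eq_map]
  induction List.finRange d with
  | nil => rfl
  | cons i L ih => simp [← ih]

lemma IsFam.iterate_pd_eq {G : (Fin d → ℕ) → (Fin d → ℝ) → ℂ} (hG : IsFam G) (q : Fin d → ℕ)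
    (i : Fin d) (n : ℕ) : Set.EqOn ((pd i)^[n] (G q)) (G (q + Pi.single i n)) (Rpos d) := by
  induction n generalizing q with
  | zero => intro x _; simp
  | succ n ih =>
    intro x hx
    rw [Function.iterate_succ_apply,
      iterate_pd_congr (g := G (q + Pi.single i 1)) (fun y hy => hG.pd_eq q i hy) i n hx,
      ih _ hx, add_assoc, ← Pi.single_add, add_comm 1 n]

lemma IsFam.mderiv_eq {G : (Fin d → ℕ) → (Fin d → ℝ) → ℂ} (hG : IsFam G)
    {f : (Fin d → ℝ) → ℂ} (hf : Set.EqOn f (G 0) (Rpos d)) (p : Fin d → ℕ) :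
    Set.EqOn (mderiv p f) (G p) (Rpos d) := by
  have key : ∀ L : List (Fin d), Set.EqOn (listDeriv p L f)
      (G (L.map fun i => Pi.single i (p i)).sum) (Rpos d) := by
    intro L
    induction L with
    | nil => simpa [listDeriv] using hf
    | cons i L ih =>
      intro x hx
      have := iterate_pd_congr ih i (p i) hx
      rw [hG.iterate_pd_eq _ _ _ hx] at this
      simpa [listDeriv, add_comm] using this
  rw [mderiv_eq_listDeriv]
  convert key _ using 2
  rw [← List.ofFn_eq_map, List.sum_ofFn, Finset.univ_sum_single]

lemma IsFam.contDiffOn {G : (Fin d → ℕ) → (Fin d → ℝ) → ℂ} (hG : IsFam G) (q : Fin d → ℕ) :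
    ContDiffOn ℝ (⊤ : ℕ∞) (G q) (Rpos d) := by
  rw [contDiffOn_infty]
  intro n
  induction n generalizing q with
  | zero =>
    exact contDiffOn_zero.2 fun x hx => (hG q x hx).continuousAt.continuousWithinAt
  | succ n ih =>
    rw [Nat.cast_succ, contDiffOn_succ_iff_fderiv_of_isOpen isOpen_Rpos]
    refine ⟨fun x hx => (hG q x hx).differentiableAt.differentiableWithinAt, by simp, ?_⟩
    refine ContDiffOn.congr ?_ fun x hx => (hG q x hx).fderiv
    refine ContDiffOn.sum fun i _ => ?_
    exact ContDiffOn.continuousLinearMap_comp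
      (ContinuousLinearMap.smulRightL ℝ (Fin d → ℝ) ℂ (ContinuousLinearMap.proj i)) (ih _)

lemma contDiffOn_pd {f : (Fin d → ℝ) → ℂ} (hf : ContDiffOn ℝ (⊤ : ℕ∞) f (Rpos d)) (i : Fin d) :
    ContDiffOn ℝ (⊤ : ℕ∞) (pd i f) (Rpos d) :=
  ((contDiffOn_infty_iff_fderiv_of_isOpen isOpen_Rpos).1 hf).2.clm_apply contDiffOn_const

lemma contDiffOn_iterate_pd {f : (Fin d → ℝ) → ℂ} (hf : ContDiffOn ℝ (⊤ : ℕ∞) f (Rpos d))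
    (i : Fin d) (n : ℕ) : ContDiffOn ℝ (⊤ : ℕ∞) ((pd i)^[n] f) (Rpos d) := by
  induction n generalizing f with
  | zero => exact hf
  | succ n ih => exact ih (contDiffOn_pd hf i)

lemma contDiffOn_listDeriv {f : (Fin d → ℝ) → ℂ} (hf : ContDiffOn ℝ (⊤ : ℕ∞) f (Rpos d))
    (p : Fin d → ℕ) (L : List (Fin d)) :
    ContDiffOn ℝ (⊤ : ℕ∞) (listDeriv p L f) (Rpos d) := by
  induction L with
  | nil => exact hf
  | cons i L ih => exact contDiffOn_iterate_pd ih i _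

lemma pd_comm {f : (Fin d → ℝ) → ℂ} (hf : ContDiffOn ℝ (⊤ : ℕ∞) f (Rpos d)) (i j : Fin d) :
    Set.EqOn (pd i (pd j f)) (pd j (pd i f)) (Rpos d) := by
  intro x hx
  have hx' := isOpen_Rpos.mem_nhds hx
  have h1 : DifferentiableAt ℝ (fderiv ℝ f) x :=
    (((contDiffOn_infty_iff_fderiv_of_isOpen isOpen_Rpos).1 hf).2.contDiffAt hx').differentiableAt
      (by simp)
  have h2 := (hf.contDiffAt hx').isSymmSndFDerivAt
    (by simpa using WithTop.coe_le_coe.2 (le_top : (2 : ℕ∞) ≤ ⊤))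
  have h3 : ∀ i j : Fin d, pd i (pd j f) x =
      fderiv ℝ (fderiv ℝ f) x (Pi.single i 1) (Pi.single j 1) := by
    intro i j
    unfold pd
    rw [fderiv_clm_apply h1 (by fun_prop)]
    simp
  rw [h3, h3, h2.eq]

lemma pd_iterate_comm {f : (Fin d → ℝ) → ℂ} (hf : ContDiffOn ℝ (⊤ : ℕ∞) f (Rpos d)) (i j : Fin d)
    (n : ℕ) : Set.EqOn (pd i ((pd j)^[n] f)) ((pd j)^[n] (pd i f)) (Rpos d) := by
  induction n generalizing f with
  | zero => exact fun _ _ => rfl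
  | succ n ih =>
    exact (ih (contDiffOn_pd hf j)).trans (iterate_pd_congr (pd_comm hf i j) j n)

lemma listDeriv_congr_index {p p' : Fin d → ℕ} {L : List (Fin d)} (h : ∀ i ∈ L, p i = p' i)
    (f : (Fin d → ℝ) → ℂ) : listDeriv p L f = listDeriv p' L f := by
  induction L with
  | nil => rfl
  | cons i L ih =>
    have := ih fun j hj => h j (List.mem_cons_of_mem _ hj)
    simp only [listDeriv, List.foldr_cons] at this ⊢
    rw [this, h i List.mem_cons_self]

lemma pd_listDeriv {f : (Fin d → ℝ) → ℂ} (hf : ContDiffOn ℝ (⊤ : ℕ∞) f (Rpos d))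
    (p : Fin d → ℕ) (j : Fin d) {L : List (Fin d)} (hL : L.Nodup) (hj : j ∈ L) :
    Set.EqOn (pd j (listDeriv p L f)) (listDeriv (p + Pi.single j 1) L f) (Rpos d) := by
  induction L with
  | nil => simp at hj
  | cons i L ih =>
    rw [List.nodup_cons] at hL
    intro x hx
    change pd j ((pd i)^[p i] (listDeriv p L f)) x =
      (pd i)^[(p + Pi.single j 1 : Fin d → ℕ) i] (listDeriv (p + Pi.single j 1) L f) x
    by_cases hij : j = i
    · subst hij
      rw [listDeriv_congr_index (p := p + Pi.single j 1) (p' := p) (L := L)]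
      · simp [Function.iterate_succ_apply']
      · intro l hl
        have : l ≠ j := fun h => hL.1 (h ▸ hl)
        simp [this]
    · rw [pd_iterate_comm (contDiffOn_listDeriv hf p L) j i _ hx,
        iterate_pd_congr (ih hL.2 ((List.mem_cons.1 hj).resolve_left hij)) i _ hx]
      simp [Ne.symm hij]

lemma isFam_mderiv {f : (Fin d → ℝ) → ℂ} (hf : ContDiffOn ℝ (⊤ : ℕ∞) f (Rpos d)) :
    IsFam fun q => mderiv q f := by
  intro q x hx
  have h1 : ContDiffOn ℝ (⊤ : ℕ∞) (mderiv q f) (Rpos d) := by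
    rw [mderiv_eq_listDeriv]; exact contDiffOn_listDeriv hf _ _
  have h2 := ((h1.contDiffAt (isOpen_Rpos.mem_nhds hx)).differentiableAt (by simp)).hasFDerivAt
  rw [eq_sum_proj_smulRight (fderiv ℝ (mderiv q f) x)] at h2
  have h3 : ∀ i : Fin d, mderiv (q + Pi.single i 1) f x =
      fderiv ℝ (mderiv q f) x (Pi.single i 1) := fun i => by
    rw [mderiv_eq_listDeriv, mderiv_eq_listDeriv]
    exact (pd_listDeriv hf q i (List.nodup_finRange d) (List.mem_finRange i) hx).symm
  simp only [h3]
  exact h2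

lemma IsFam.isSPlus {G : (Fin d → ℕ) → (Fin d → ℝ) → ℂ} (hG : IsFam G) (hR : IsRapid G)
    (hc : ∀ q, ContinuousOn (G q) {x | ∀ i, 0 ≤ x i}) : IsSPlus (G 0) := by
  have h := hG.mderiv_eq (f := G 0) fun _ _ => rfl
  refine ⟨hG.contDiffOn 0, fun p => ⟨G p, hc p, fun x hx => (h p hx).symm⟩, fun k p => ?_⟩
  obtain ⟨C, hC⟩ := hR k p
  exact ⟨C, fun x hx => by rw [h p hx]; exact hC x hx⟩

lemma IsSPlus.isFam {f : (Fin d → ℝ) → ℂ} (hf : IsSPlus f) : IsFam fun q => mderiv q f :=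
  isFam_mderiv hf.1

lemma IsSPlus.isRapid {f : (Fin d → ℝ) → ℂ} (hf : IsSPlus f) : IsRapid fun q => mderiv q f :=
  hf.2.2

lemma mderiv_zero (f : (Fin d → ℝ) → ℂ) : mderiv 0 f = f := by
  rw [mderiv_eq_listDeriv, listDeriv]
  simp

end Families

/-- The Bessel–Clifford function `u ↦ ∑ (-u)^k / (k! (k+p)!)`. -/
def besselC (p : ℕ) (u : ℝ) : ℝ := ∑' k : ℕ, (-u) ^ k / ((k.factorial : ℝ) * (k + p).factorial)

lemma norm_besselC_term_le (p k : ℕ) (u : ℝ) :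
    ‖(-u) ^ k / ((k.factorial : ℝ) * (k + p).factorial)‖ ≤ |u| ^ k / k.factorial := by
  have h1 : (1 : ℝ) ≤ (k + p).factorial := by exact_mod_cast Nat.factorial_pos _
  have h2 : (0 : ℝ) < k.factorial := by exact_mod_cast Nat.factorial_pos _
  rw [norm_div, norm_pow, norm_neg, Real.norm_eq_abs, Real.norm_of_nonneg (by positivity)]
  gcongr
  nlinarith

lemma summable_besselC (p : ℕ) (u : ℝ) :
    Summable fun k : ℕ => (-u) ^ k / ((k.factorial : ℝ) * (k + p).factorial) :=
  .of_norm_bounded (Real.summable_pow_div_factorial _) fun k => norm_besselC_term_le p k u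

lemma hasDerivAt_besselC (p : ℕ) (u : ℝ) : HasDerivAt (besselC p) (-besselC (p + 1) u) u := by
  have hk : ∀ (k : ℕ) (v : ℝ), HasDerivAt
      (fun v : ℝ => (-v) ^ k / ((k.factorial : ℝ) * (k + p).factorial))
      (-(k * (-v) ^ (k - 1)) / ((k.factorial : ℝ) * (k + p).factorial)) v := fun k v => by
    have := ((hasDerivAt_neg v).fun_pow k).div_const ((k.factorial : ℝ) * (k + p).factorial)
    simpa using this
  have hs : Summable fun k : ℕ => (k : ℝ) * (|u| + 1) ^ (k - 1) / k.factorial := by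
    rw [← summable_nat_add_iff 1]
    refine (Real.summable_pow_div_factorial (|u| + 1)).congr fun k => ?_
    rw [Nat.factorial_succ]
    push_cast
    have : (k : ℝ) + 1 ≠ 0 := by positivity
    have h2 : (k.factorial : ℝ) ≠ 0 := by positivity
    field_simp
  have hu : u ∈ Metric.ball (0 : ℝ) (|u| + 1) := by simp
  have := hasDerivAt_tsum_of_isPreconnected hs Metric.isOpen_ball
    (convex_ball (0 : ℝ) (|u| + 1)).isPreconnected (fun k v _ => hk k v) (fun k v hv => ?_) hu
    (summable_besselC p u) hu
  · refine this.congr_deriv ?_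
    rw [Summable.tsum_eq_zero_add]
    · simp only [besselC, ← tsum_neg]
      simp only [Nat.cast_zero, zero_mul, neg_zero, zero_div, zero_add]
      refine tsum_congr fun k => ?_
      rw [Nat.add_sub_cancel, Nat.factorial_succ, show k + 1 + p = k + (p + 1) by ring]
      push_cast
      have : (k : ℝ) + 1 ≠ 0 := by positivity
      have h2 : (k.factorial : ℝ) ≠ 0 := by positivity
      field_simp
    · refine .of_norm_bounded hs fun k => ?_
      rw [norm_div, norm_neg, norm_mul, norm_pow, norm_neg, Real.norm_natCast,
        Real.norm_of_nonneg (by positivity : (0:ℝ) ≤ (k.factorial : ℝ) * (k + p).factorial),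
        Real.norm_eq_abs]
      have h1 : (1 : ℝ) ≤ (k + p).factorial := by exact_mod_cast Nat.factorial_pos _
      have h2 : (0 : ℝ) < k.factorial := by exact_mod_cast Nat.factorial_pos _
      gcongr
      · linarith
      · nlinarith
  · rw [norm_div, norm_neg, norm_mul, norm_pow, norm_neg, Real.norm_natCast,
      Real.norm_of_nonneg (by positivity : (0:ℝ) ≤ (k.factorial : ℝ) * (k + p).factorial)]
    have h1 : (1 : ℝ) ≤ (k + p).factorial := by exact_mod_cast Nat.factorial_pos _
    have h2 : (0 : ℝ) < k.factorial := by exact_mod_cast Nat.factorial_pos _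
    have h3 : ‖v‖ ≤ |u| + 1 := by simpa using (mem_ball_zero_iff.1 hv).le
    gcongr
    nlinarith

lemma continuous_besselC (p : ℕ) : Continuous (besselC p) :=
  continuous_iff_continuousAt.2 fun u => (hasDerivAt_besselC p u).continuousAt

lemma besselC_recurrence (p : ℕ) (u : ℝ) :
    besselC p u + u * besselC (p + 2) u = (p + 1) * besselC (p + 1) u := by
  unfold besselC
  rw [← tsum_mul_left, ← tsum_mul_left, (summable_besselC p u).tsum_eq_zero_add,
    ((summable_besselC (p + 1) u).mul_left ((p : ℝ) + 1)).tsum_eq_zero_add, add_assoc,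
    ← Summable.tsum_add ((summable_nat_add_iff 1).2 (summable_besselC p u))
      ((summable_besselC (p + 2) u).mul_left u)]
  congr 1
  · have : (p.factorial : ℝ) ≠ 0 := by positivity
    have : (p : ℝ) + 1 ≠ 0 := by positivity
    simp [Nat.factorial_succ]
    field_simp
  · refine tsum_congr fun k => ?_
    rw [show k + (p + 2) = (k + p + 1) + 1 by ring, show k + 1 + p = k + p + 1 by ring,
      show k + 1 + (p + 1) = (k + p + 1) + 1 by ring, Nat.factorial_succ (k + p + 1),
      Nat.factorial_succ k]
    have h1 : ((k + p + 1).factorial : ℝ) ≠ 0 := by positivity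
    have h2 : (k.factorial : ℝ) ≠ 0 := by positivity
    have h3 : (k : ℝ) + 1 ≠ 0 := by positivity
    have h4 : (k : ℝ) + p + 1 + 1 ≠ 0 := by positivity
    push_cast
    field_simp
    ring

lemma besselC_zero_right (p : ℕ) : besselC p 0 = 1 / p.factorial := by
  unfold besselC
  rw [tsum_eq_single 0 fun k hk => by simp [hk]]
  simp

lemma abs_besselC_le_one (p : ℕ) {u : ℝ} (hu : 0 ≤ u) : |besselC p u| ≤ 1 := by
  have hd : ∀ v, HasDerivAt (fun v => besselC p v ^ 2 + v * besselC (p + 1) v ^ 2)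
      (-(2 * p + 1) * besselC (p + 1) v ^ 2) v := fun v => by
    have := ((hasDerivAt_besselC p v).fun_pow 2).fun_add
      ((hasDerivAt_id' v).fun_mul ((hasDerivAt_besselC (p + 1) v).fun_pow 2))
    refine this.congr_deriv ?_
    have h := besselC_recurrence p v
    simp only [Nat.cast_ofNat]
    linear_combination -2 * besselC (p + 1) v * h
  have ha : Antitone fun v => besselC p v ^ 2 + v * besselC (p + 1) v ^ 2 :=
    antitone_of_hasDerivAt_nonpos hd fun v => by
      have : (0 : ℝ) ≤ (2 * p + 1) * besselC (p + 1) v ^ 2 := by positivity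
      simp only [Pi.zero_apply]
      linarith
  have h := ha hu
  simp only [zero_mul, add_zero, besselC_zero_right] at h
  have h1 : (1 : ℝ) / p.factorial ≤ 1 :=
    div_le_one_of_le₀ (by exact_mod_cast Nat.factorial_pos _) (by positivity)
  have h0 : (0 : ℝ) ≤ 1 / p.factorial := by positivity
  have h2 : 0 ≤ u * besselC (p + 1) u ^ 2 := by positivity
  exact abs_le_one_iff_mul_self_le_one.2 (by nlinarith)

lemma integral_pow_mul_exp_neg {s : ℝ} (hs : 0 < s) (k : ℕ) :
    ∫ x in Set.Ioi (0 : ℝ), x ^ k * Real.exp (-(s * x)) = k.factorial / s ^ (k + 1) := by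
  have := Real.integral_rpow_mul_exp_neg_mul_Ioi (a := (k : ℝ) + 1) (r := s) (by positivity) hs
  rw [Real.Gamma_nat_eq_factorial] at this
  simp only [add_sub_cancel_right, Real.rpow_natCast] at this
  rw [this, ← Nat.cast_succ, Real.rpow_natCast]
  simp
  ring

lemma integrableOn_pow_mul_exp_neg {s : ℝ} (hs : 0 < s) (k : ℕ) :
    IntegrableOn (fun x : ℝ => x ^ k * Real.exp (-(s * x))) (Set.Ioi 0) := by
  refine Integrable.of_integral_ne_zero ?_
  rw [integral_pow_mul_exp_neg hs]
  positivity

lemma integral_exp_mul_besselC {s : ℝ} (hs : 0 < s) {t : ℝ} (ht : 0 ≤ t) :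
    ∫ x in Set.Ioi (0 : ℝ), Real.exp (-(s * x)) * besselC 0 (x * t) =
      s⁻¹ * Real.exp (-(s⁻¹ * t)) := by
  let F : ℕ → ℝ → ℝ := fun k x =>
    ((-t) ^ k / ((k.factorial : ℝ) * k.factorial)) * (x ^ k * Real.exp (-(s * x)))
  have hF : ∀ k, Integrable (F k) (volume.restrict (Set.Ioi 0)) := fun k =>
    (integrableOn_pow_mul_exp_neg hs k).const_mul _
  have hval : ∀ r : ℝ, ∀ k : ℕ, r ^ k / ((k.factorial : ℝ) * k.factorial) *
      (k.factorial / s ^ (k + 1)) = s⁻¹ * ((s⁻¹ * r) ^ k / k.factorial) := fun r k => by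
    have : (k.factorial : ℝ) ≠ 0 := by positivity
    rw [mul_pow, inv_pow]
    field_simp
    ring
  have hint : ∀ k, ∫ x in Set.Ioi 0, F k x = s⁻¹ * ((s⁻¹ * -t) ^ k / k.factorial) := fun k => by
    rw [integral_const_mul, integral_pow_mul_exp_neg hs, hval]
  have hnorm : ∀ k, ∫ x in Set.Ioi 0, ‖F k x‖ = s⁻¹ * ((s⁻¹ * t) ^ k / k.factorial) := fun k => by
    rw [← hval, ← integral_pow_mul_exp_neg hs, ← integral_const_mul]
    refine setIntegral_congr_fun measurableSet_Ioi fun x hx => ?_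
    have hx' : (0:ℝ) ≤ x := le_of_lt hx
    simp only [F]
    rw [norm_mul, norm_div, norm_pow, norm_neg, Real.norm_of_nonneg ht,
      Real.norm_of_nonneg (by positivity), Real.norm_of_nonneg (by positivity)]
  have hsum := hasSum_integral_of_summable_integral_norm hF
    (by simp only [hnorm]; exact (Real.summable_pow_div_factorial _).mul_left _)
  have h2 : HasSum (fun k => s⁻¹ * ((s⁻¹ * -t) ^ k / k.factorial))
      (s⁻¹ * Real.exp (-(s⁻¹ * t))) := by
    refine HasSum.mul_left _ ?_
    rw [← mul_neg, Real.exp_eq_exp_ℝ]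
    exact NormedSpace.expSeries_div_hasSum_exp _
  simp only [hint] at hsum
  rw [h2.unique hsum]
  refine setIntegral_congr_fun measurableSet_Ioi fun x _ => ?_
  simp only [besselC, F, ← tsum_mul_left]
  refine tsum_congr fun k => ?_
  rw [show -(x * t) = x * -t by ring, mul_pow, add_zero]
  ring

lemma integrableOn_exp_neg {s : ℝ} (hs : 0 < s) :
    IntegrableOn (fun x : ℝ => Real.exp (-(s * x))) (Set.Ioi 0) := by
  simpa using integrableOn_pow_mul_exp_neg hs 0

lemma K0_neg_ofReal (u : ℝ) : K0 (-(u : ℂ)) = besselC 0 u := by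
  unfold K0 besselC
  rw [Complex.ofReal_tsum]
  refine tsum_congr fun k => ?_
  push_cast
  simp [pow_two]

/-- The kernel `∏ x_l^{m_l} B_{p_l}(x_l s_l)`. -/
def kern {d : ℕ} (m p : Fin d → ℕ) (x s : Fin d → ℝ) : ℝ :=
  ∏ l, x l ^ m l * besselC (p l) (x l * s l)

/-- The Hankel–Clifford type integral of `F` against `kern m p`. -/
def hankelC {d : ℕ} (F : (Fin d → ℝ) → ℂ) (m p : Fin d → ℕ) (s : Fin d → ℝ) : ℂ :=
  ∫ x in Rpos d, F x * (kern m p x s : ℂ)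

section Kernel
variable {d : ℕ}

lemma abs_kern_le (m p : Fin d → ℕ) {x s : Fin d → ℝ} (hx : ∀ i, 0 ≤ x i) (hs : ∀ i, 0 ≤ s i) :
    |kern m p x s| ≤ ∏ l, x l ^ m l := by
  unfold kern
  rw [Finset.abs_prod]
  refine Finset.prod_le_prod (fun _ _ => abs_nonneg _) fun l _ => ?_
  rw [abs_mul, abs_of_nonneg (pow_nonneg (hx l) _)]
  exact mul_le_of_le_one_right (pow_nonneg (hx l) _)
    (abs_besselC_le_one _ (mul_nonneg (hx l) (hs l)))

lemma continuous_kern (m p : Fin d → ℕ) : Continuous fun y : (Fin d → ℝ) × (Fin d → ℝ) =>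
    kern m p y.1 y.2 := by
  unfold kern
  refine continuous_finsetProd _ fun l _ => ?_
  have := continuous_besselC (p l)
  fun_prop

lemma kern_add_single (m p : Fin d → ℕ) (i : Fin d) (a b : ℕ) (x s : Fin d → ℝ) :
    kern (m + Pi.single i a) (p + Pi.single i b) x s =
      (x i ^ (m i + a) * besselC (p i + b) (x i * s i)) *
        ∏ l ∈ univ.erase i, x l ^ m l * besselC (p l) (x l * s l) := by
  unfold kern
  rw [← Finset.mul_prod_erase _ _ (mem_univ i)]
  congr 1
  · simp
  · refine Finset.prod_congr rfl fun l hl => ?_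
    simp [Finset.ne_of_mem_erase hl]

lemma kern_recurrence (m p : Fin d → ℕ) (i : Fin d) (x s : Fin d → ℝ) :
    kern m p x s = (p i + 1) * kern m (p + Pi.single i 1) x s -
      s i * kern (m + Pi.single i 1) (p + Pi.single i 2) x s := by
  have h0 := kern_add_single m p i 0 0 x s
  have h1 := kern_add_single m p i 0 1 x s
  have h2 := kern_add_single m p i 1 2 x s
  simp only [Pi.single_zero, add_zero] at h0 h1
  rw [h0, h1, h2]
  linear_combination (x i ^ m i * ∏ l ∈ univ.erase i, x l ^ m l * besselC (p l) (x l * s l)) *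
    besselC_recurrence (p i) (x i * s i)

lemma hasDerivAt_kern_update (m p : Fin d → ℕ) (i : Fin d) (x s : Fin d → ℝ) :
    HasDerivAt (fun y => kern (m + Pi.single i 1) p (Function.update x i y) s)
      ((m i + 1) * kern m p x s - s i * kern (m + Pi.single i 1) (p + Pi.single i 1) x s)
      (x i) := by
  have h0 := kern_add_single m p i 0 0 x s
  have h1 := fun x => kern_add_single m p i 1 0 x s
  have h2 := kern_add_single m p i 1 1 x s
  simp only [Pi.single_zero, add_zero] at h0 h1
  rw [h0, h2]
  simp only [h1, Function.update_self]
  have h3 : ∀ y, ∏ l ∈ univ.erase i, Function.update x i y l ^ m l *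
      besselC (p l) (Function.update x i y l * s l) =
      ∏ l ∈ univ.erase i, x l ^ m l * besselC (p l) (x l * s l) := fun y =>
    Finset.prod_congr rfl fun l hl => by simp [Finset.ne_of_mem_erase hl]
  simp only [h3]
  have h4 : HasDerivAt (fun y => besselC (p i) (y * s i))
      (-besselC (p i + 1) (x i * s i) * (1 * s i)) (x i) :=
    HasDerivAt.comp (h := fun y => y * s i) (x i) (hasDerivAt_besselC (p i) (x i * s i))
      ((hasDerivAt_id' (x i)).mul_const (s i))
  refine ((((hasDerivAt_id' (x i)).fun_pow (m i + 1)).fun_mul h4).mul_const _).congr_deriv ?_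
  push_cast
  ring

lemma hasFDerivAt_kern (m p : Fin d → ℕ) (x s : Fin d → ℝ) :
    HasFDerivAt (fun s => kern m p x s) (∑ i,
      (-kern (m + Pi.single i 1) (p + Pi.single i 1) x s) •
        ContinuousLinearMap.proj (R := ℝ) (φ := fun _ : Fin d => ℝ) i) s := by
  unfold kern
  have h : ∀ i ∈ (univ : Finset (Fin d)), HasFDerivAt
      (fun s : Fin d → ℝ => x i ^ m i * besselC (p i) (x i * s i))
      ((x i ^ m i * (-besselC (p i + 1) (x i * s i) * x i)) •
        ContinuousLinearMap.proj (R := ℝ) (φ := fun _ : Fin d => ℝ) i) s := by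
    intro i _
    have h1 : HasDerivAt (fun y => x i ^ m i * besselC (p i) (x i * y))
        (x i ^ m i * (-besselC (p i + 1) (x i * s i) * (x i * 1))) (s i) :=
      (HasDerivAt.comp (h := fun y => x i * y) (s i) (hasDerivAt_besselC (p i) (x i * s i))
        ((hasDerivAt_id' (s i)).const_mul (x i))).const_mul _
    rw [mul_one] at h1
    exact HasDerivAt.comp_hasFDerivAt (f := fun s : Fin d → ℝ => s i)
      (h₂ := fun y => x i ^ m i * besselC (p i) (x i * y)) s h1 (hasFDerivAt_apply i s)
  refine (HasFDerivAt.finsetProd h).congr_fderiv (Finset.sum_congr rfl fun i _ => ?_)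
  rw [smul_smul]
  congr 1
  have h2 := kern_add_single m p i 1 1 x s
  unfold kern at h2
  rw [h2]
  ring

end Kernel

section Integrals
variable {d : ℕ}

lemma integrable_prod_inv : Integrable (fun x : Fin d → ℝ => ∏ l, (1 + x l ^ 2)⁻¹) := by
  rw [volume_pi]
  exact Integrable.fintype_prod (f := fun _ (y : ℝ) => (1 + y ^ 2)⁻¹) fun _ =>
    integrable_inv_one_add_sq

lemma IsRapid.exists_bound {G : (Fin d → ℕ) → (Fin d → ℝ) → ℂ} (hR : IsRapid G)
    (m q : Fin d → ℕ) : ∃ C, 0 ≤ C ∧ ∀ x ∈ Rpos d,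
      (∏ l, x l ^ m l) * ‖G q x‖ ≤ C * ∏ l, (1 + x l ^ 2)⁻¹ := by
  choose C hC using fun S : Finset (Fin d) => hR (fun l => m l + if l ∈ S then 2 else 0) q
  refine ⟨∑ S : Finset (Fin d), |C S|, Finset.sum_nonneg fun _ _ => abs_nonneg _, fun x hx => ?_⟩
  have hpos : 0 < ∏ l, (1 + x l ^ 2) := Finset.prod_pos fun l _ => by positivity
  rw [Finset.prod_inv_distrib, ← div_eq_mul_inv, le_div_iff₀ hpos, Finset.prod_one_add,
    Finset.mul_sum, ← Finset.powerset_univ]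
  refine Finset.sum_le_sum fun S _ => ?_
  refine le_trans (le_of_eq ?_) ((hC S x hx).trans (le_abs_self _))
  simp only [pow_add, Finset.prod_mul_distrib]
  have : ∏ l, x l ^ (if l ∈ S then 2 else 0) = ∏ l ∈ S, x l ^ 2 := by
    simp [Finset.prod_ite_mem, pow_ite]
  rw [this]
  ring

lemma IsFam.continuousOn {G : (Fin d → ℕ) → (Fin d → ℝ) → ℂ} (hG : IsFam G) (q : Fin d → ℕ) :
    ContinuousOn (G q) (Rpos d) := fun x hx => (hG q x hx).continuousAt.continuousWithinAt

variable {G : (Fin d → ℕ) → (Fin d → ℝ) → ℂ}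

lemma aestronglyMeasurable_mul_kern (hG : IsFam G) (q m p : Fin d → ℕ) (s : Fin d → ℝ) :
    AEStronglyMeasurable (fun x => G q x * (kern m p x s : ℂ)) (volume.restrict (Rpos d)) := by
  refine ContinuousOn.aestronglyMeasurable ((hG.continuousOn q).mul ?_) measurableSet_Rpos
  refine Continuous.continuousOn ?_
  exact Complex.continuous_ofReal.comp
    ((continuous_kern m p).comp (by fun_prop : Continuous fun x : Fin d → ℝ => (x, s)))

lemma integrable_bound (hG : IsFam G) (hR : IsRapid G) (q m : Fin d → ℕ) :
    IntegrableOn (fun x => (∏ l, x l ^ m l) * ‖G q x‖) (Rpos d) := by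
  obtain ⟨C, -, hC⟩ := hR.exists_bound m q
  refine (integrable_prod_inv.integrableOn.const_mul C).mono' ?_ ?_
  · exact ContinuousOn.aestronglyMeasurable
      ((by fun_prop : Continuous fun x : Fin d → ℝ => ∏ l, x l ^ m l).continuousOn.mul
        (hG.continuousOn q).norm) measurableSet_Rpos
  · refine (ae_restrict_mem measurableSet_Rpos).mono fun x hx => ?_
    rw [Real.norm_of_nonneg (mul_nonneg (Finset.prod_nonneg fun l _ => pow_nonneg (hx l).le _)
      (norm_nonneg _))]
    exact hC x hx

lemma norm_mul_kern_le (F : (Fin d → ℝ) → ℂ) (m p : Fin d → ℕ) {x s : Fin d → ℝ}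
    (hx : ∀ i, 0 ≤ x i) (hs : ∀ i, 0 ≤ s i) :
    ‖F x * (kern m p x s : ℂ)‖ ≤ (∏ l, x l ^ m l) * ‖F x‖ := by
  rw [norm_mul, mul_comm, Complex.norm_real]
  exact mul_le_mul_of_nonneg_right (abs_kern_le m p hx hs) (norm_nonneg _)

lemma integrable_mul_kern (hG : IsFam G) (hR : IsRapid G) (q m p : Fin d → ℕ) {s : Fin d → ℝ}
    (hs : ∀ i, 0 ≤ s i) :
    IntegrableOn (fun x => G q x * (kern m p x s : ℂ)) (Rpos d) :=
  (integrable_bound hG hR q m).mono' (aestronglyMeasurable_mul_kern hG q m p s)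
    ((ae_restrict_mem measurableSet_Rpos).mono fun _ hx =>
      norm_mul_kern_le _ m p (fun i => (hx i).le) hs)

lemma continuousOn_hankelC (hG : IsFam G) (hR : IsRapid G) (q m p : Fin d → ℕ) :
    ContinuousOn (hankelC (G q) m p) {s | ∀ i, 0 ≤ s i} := by
  refine continuousOn_of_dominated (fun s _ => aestronglyMeasurable_mul_kern hG q m p s)
    (fun _ hs => (ae_restrict_mem measurableSet_Rpos).mono fun _ hx =>
      norm_mul_kern_le _ m p (fun i => (hx i).le) hs) (integrable_bound hG hR q m)
    (ae_of_all _ fun x => Continuous.continuousOn ?_)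
  exact continuous_const.mul (Complex.continuous_ofReal.comp
    ((continuous_kern m p).comp (by fun_prop : Continuous fun s : Fin d → ℝ => (x, s))))

lemma exists_norm_hankelC_le (hG : IsFam G) (hR : IsRapid G) (q m p : Fin d → ℕ) :
    ∃ C, ∀ s ∈ Rpos d, ‖hankelC (G q) m p s‖ ≤ C :=
  ⟨_, fun _ hs => norm_integral_le_of_norm_le (integrable_bound hG hR q m)
    ((ae_restrict_mem measurableSet_Rpos).mono fun _ hx =>
      norm_mul_kern_le _ m p (fun i => (hx i).le) fun i => (hs i).le)⟩

lemma hasFDerivAt_hankelC (hG : IsFam G) (hR : IsRapid G) (q m p : Fin d → ℕ) {s : Fin d → ℝ}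
    (hs : s ∈ Rpos d) : HasFDerivAt (hankelC (G q) m p) (∑ i,
      (ContinuousLinearMap.proj (R := ℝ) (φ := fun _ : Fin d => ℝ) i).smulRight
        (-hankelC (G q) (m + Pi.single i 1) (p + Pi.single i 1) s)) s := by
  let F' : (Fin d → ℝ) → (Fin d → ℝ) → ((Fin d → ℝ) →L[ℝ] ℂ) := fun s x => ∑ i,
    (ContinuousLinearMap.proj (R := ℝ) (φ := fun _ : Fin d => ℝ) i).smulRight
      (-(G q x * (kern (m + Pi.single i 1) (p + Pi.single i 1) x s : ℂ)))
  have hb : Integrable (fun x => ∑ i, (∏ l, x l ^ (m + Pi.single i 1 : Fin d → ℕ) l) * ‖G q x‖)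
      (volume.restrict (Rpos d)) :=
    integrable_finsetSum _ fun i _ => integrable_bound hG hR q _
  have hm : AEStronglyMeasurable (F' s) (volume.restrict (Rpos d)) := by
    refine Finset.aestronglyMeasurable_fun_sum _ fun i _ => ?_
    exact (ContinuousLinearMap.smulRightL ℝ (Fin d → ℝ) ℂ
      (ContinuousLinearMap.proj i)).continuous.comp_aestronglyMeasurable
      (aestronglyMeasurable_mul_kern hG q _ _ s).neg
  have hle : ∀ x ∈ Rpos d, ∀ s ∈ Rpos d, ‖F' s x‖ ≤
      ∑ i, (∏ l, x l ^ (m + Pi.single i 1 : Fin d → ℕ) l) * ‖G q x‖ := by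
    intro x hx s hs
    refine norm_sum_le_of_le _ fun i _ => ?_
    rw [ContinuousLinearMap.norm_smulRight_apply, norm_neg]
    refine (mul_le_of_le_one_left (norm_nonneg _) ?_).trans
      (norm_mul_kern_le _ _ _ (fun i => (hx i).le) fun i => (hs i).le)
    exact ContinuousLinearMap.opNorm_le_bound _ zero_le_one fun v => by
      simpa using norm_le_pi_norm v i
  have key := hasFDerivAt_integral_of_dominated_of_fderiv_le (μ := volume.restrict (Rpos d))
    (F := fun s x => G q x * (kern m p x s : ℂ)) (F' := F') (isOpen_Rpos.mem_nhds hs)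
    (Eventually.of_forall fun s => aestronglyMeasurable_mul_kern hG q m p s)
    (integrable_mul_kern hG hR q m p fun i => (hs i).le) hm
    ((ae_restrict_mem measurableSet_Rpos).mono hle) hb
    (ae_of_all _ fun x s _ => by
      have h1 := (Complex.ofRealCLM.hasFDerivAt.comp s (hasFDerivAt_kern m p x s)).const_mul (G q x)
      refine h1.congr_fderiv ?_
      ext v
      simp only [F', _root_.smul_apply, ContinuousLinearMap.comp_apply,
        _root_.sum_apply, Complex.ofRealCLM_apply, ContinuousLinearMap.smulRight_apply,
        ContinuousLinearMap.proj_apply, smul_eq_mul, Complex.real_smul]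
      push_cast
      rw [Finset.mul_sum]
      exact Finset.sum_congr rfl fun i _ => by ring)
  refine key.congr_fderiv ?_
  rw [eq_sum_proj_smulRight (∫ x in Rpos d, F' s x)]
  refine Finset.sum_congr rfl fun i _ => ?_
  rw [ContinuousLinearMap.integral_apply
    (hb.mono' hm ((ae_restrict_mem measurableSet_Rpos).mono fun x hx => hle x hx s hs))]
  congr 1
  rw [hankelC, ← integral_neg]
  refine integral_congr_ae (ae_of_all _ fun x => ?_)
  exact sum_proj_smulRight_single (fun i => -(G q x *
    (kern (m + Pi.single i 1) (p + Pi.single i 1) x s : ℂ))) i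

end Integrals

section Parts
variable {d : ℕ}

lemma integral_Ioi_deriv_eq_zero {u u' : ℝ → ℂ} {C : ℝ}
    (hd : ∀ y ∈ Set.Ioi (0 : ℝ), HasDerivAt u (u' y) y) (hi : IntegrableOn u' (Set.Ioi 0))
    (hb : ∀ y ∈ Set.Ioi (0 : ℝ), ‖u y‖ ≤ C * (y * (1 + y ^ 2)⁻¹)) :
    ∫ y in Set.Ioi (0 : ℝ), u' y = 0 := by
  have hlim : Tendsto (fun y : ℝ => C * (y * (1 + y ^ 2)⁻¹)) atTop (nhds 0) := by
    have h1 : Tendsto (fun y : ℝ => C * y⁻¹) atTop (nhds 0) := by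
      simpa using tendsto_inv_atTop_zero.const_mul C
    have h2 : Tendsto (fun y : ℝ => y * (1 + y ^ 2)⁻¹) atTop (nhds 0) := by
      refine squeeze_zero' ?_ ?_ tendsto_inv_atTop_zero
      · filter_upwards [eventually_gt_atTop 0] with y hy using by positivity
      · filter_upwards [eventually_gt_atTop 0] with y hy
        rw [← div_eq_mul_inv, div_le_iff₀ (by positivity)]
        field_simp
        nlinarith
    simpa using h2.const_mul C
  have hlim0 : Tendsto (fun y : ℝ => C * (y * (1 + y ^ 2)⁻¹)) (nhdsWithin 0 (Set.Ioi 0))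
      (nhds 0) := by
    have hc : Continuous fun y : ℝ => C * (y * (1 + y ^ 2)⁻¹) := by
      refine continuous_const.mul (continuous_id.mul (Continuous.inv₀ (by fun_prop) fun y => ?_))
      positivity
    simpa using (hc.tendsto 0).mono_left nhdsWithin_le_nhds
  have hmem : ∀ᶠ y in nhdsWithin (0 : ℝ) (Set.Ioi 0), ‖u y‖ ≤ C * (y * (1 + y ^ 2)⁻¹) :=
    eventually_nhdsWithin_of_forall hb
  have key := integral_Ioi_of_hasDerivAt_of_tendsto (f := Function.update u 0 0) (f' := u')
    (a := 0) (m := 0) ?_ ?_ hi ?_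
  · simpa using key
  · rw [← continuousWithinAt_Ioi_iff_Ici, continuousWithinAt_update_same]
    refine squeeze_zero_norm' ?_ (hlim0.mono_left (nhdsWithin_mono _ Set.sdiff_subset))
    exact eventually_nhdsWithin_of_forall fun y hy => hb y hy.1
  · intro y hy
    refine (hd y hy).congr_of_eventuallyEq ?_
    filter_upwards [lt_mem_nhds hy] with v hv
    exact Function.update_of_ne (ne_of_gt hv) _ _
  · refine squeeze_zero_norm' ?_ hlim
    filter_upwards [eventually_gt_atTop 0] with y hy
    rw [Function.update_of_ne (ne_of_gt hy)]
    exact hb y hy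

lemma integral_partial_eq_zero (i : Fin d) {u u' : (Fin d → ℝ) → ℂ} {C : ℝ}
    (hd : ∀ x ∈ Rpos d, HasDerivAt (fun y => u (Function.update x i y)) (u' x) (x i))
    (hi : IntegrableOn u' (Rpos d))
    (hb : ∀ x ∈ Rpos d, ‖u x‖ ≤ C * (x i * (1 + x i ^ 2)⁻¹)) :
    ∫ x in Rpos d, u' x = 0 := by
  obtain ⟨n, rfl⟩ : ∃ n, d = n + 1 := ⟨d - 1, by have := i.pos; omega⟩
  let e := MeasurableEquiv.piFinSuccAbove (fun _ : Fin (n + 1) => ℝ) i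
  have he : MeasurePreserving e.symm volume volume :=
    (volume_preserving_piFinSuccAbove (fun _ : Fin (n + 1) => ℝ) i).symm e
  have hes : ∀ y, e.symm y = i.insertNth y.1 y.2 := fun y => rfl
  have hpre : e.symm ⁻¹' (Rpos (n + 1)) = Set.Ioi 0 ×ˢ Rpos n := by
    ext y
    simp [hes, Rpos, Fin.forall_iff_succAbove i]
  have hi' : IntegrableOn (fun y => u' (e.symm y)) (Set.Ioi 0 ×ˢ Rpos n) := by
    rw [← hpre]
    exact (he.integrableOn_comp_preimage e.symm.measurableEmbedding).2 hi
  rw [← he.setIntegral_preimage_emb e.symm.measurableEmbedding, hpre]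
  rw [IntegrableOn, Measure.volume_eq_prod, ← Measure.prod_restrict] at hi'
  rw [Measure.volume_eq_prod, ← Measure.prod_restrict, integral_prod_symm _ hi']
  refine integral_eq_zero_of_ae ?_
  filter_upwards [hi'.prod_left_ae, ae_restrict_mem measurableSet_Rpos] with x' hx' hx'pos
  have hmem : ∀ y ∈ Set.Ioi (0 : ℝ), e.symm (y, x') ∈ Rpos (n + 1) := fun y hy => by
    have : (y, x') ∈ e.symm ⁻¹' (Rpos (n + 1)) := by rw [hpre]; exact ⟨hy, hx'pos⟩
    exact this
  have hii : ∀ y, e.symm (y, x') i = y := fun y => by simp [hes]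
  refine integral_Ioi_deriv_eq_zero (u := fun y => u (e.symm (y, x'))) (C := C) (fun y hy => ?_)
    hx' fun y hy => ?_
  · have := hd _ (hmem y hy)
    rw [hii] at this
    simpa only [hes, Fin.update_insertNth] using this
  · have := hb _ (hmem y hy)
    rwa [hii] at this

variable {G : (Fin d → ℕ) → (Fin d → ℝ) → ℂ}

lemma prod_pow_add_single (m : Fin d → ℕ) (i : Fin d) (x : Fin d → ℝ) :
    ∏ l, x l ^ (m + Pi.single i 1 : Fin d → ℕ) l = x i * ∏ l, x l ^ m l := by
  simp only [Pi.add_apply, pow_add, Finset.prod_mul_distrib]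
  rw [mul_comm]
  congr 1
  rw [Finset.prod_eq_single i (fun l _ hl => by simp [hl]) (by simp)]
  simp

lemma hankelC_by_parts (hG : IsFam G) (hR : IsRapid G) (q m p : Fin d → ℕ) (i : Fin d)
    {s : Fin d → ℝ} (hs : ∀ i, 0 ≤ s i) :
    s i * hankelC (G q) (m + Pi.single i 1) (p + Pi.single i 1) s =
      hankelC (G (q + Pi.single i 1)) (m + Pi.single i 1) p s +
        (m i + 1) * hankelC (G q) m p s := by
  have h1 := integrable_mul_kern hG hR (q + Pi.single i 1) (m + Pi.single i 1) p hs
  have h2 := integrable_mul_kern hG hR q m p hs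
  have h3 := integrable_mul_kern hG hR q (m + Pi.single i 1) (p + Pi.single i 1) hs
  obtain ⟨C, hC0, hC⟩ := hR.exists_bound m q
  have key := integral_partial_eq_zero i (u := fun x => G q x * (kern (m + Pi.single i 1) p x s : ℂ))
    (u' := fun x => (G (q + Pi.single i 1) x * (kern (m + Pi.single i 1) p x s : ℂ) +
      (m i + 1) * (G q x * (kern m p x s : ℂ))) -
      s i * (G q x * (kern (m + Pi.single i 1) (p + Pi.single i 1) x s : ℂ)))
    (C := C) ?_ ((h1.add (h2.const_mul _)).sub (h3.const_mul _)) ?_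
  · rw [integral_sub (h1.fun_add (h2.const_mul _)) (h3.const_mul _),
      integral_add h1 (h2.const_mul _), integral_const_mul, integral_const_mul] at key
    exact (sub_eq_zero.1 key).symm
  · intro x hx
    have hu := Function.update_eq_self i x
    have e1 : HasDerivAt (fun y => G q (Function.update x i y)) (G (q + Pi.single i 1) x) (x i) := by
      have hf := hG q x hx
      rw [← hu] at hf
      have := hf.comp_hasDerivAt (x i) (hasDerivAt_update x i (x i))
      rw [hu] at this
      exact this.congr_deriv (sum_proj_smulRight_single (fun j => G (q + Pi.single j 1) x) i)
    have e2 := (hasDerivAt_kern_update m p i x s).ofReal_comp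
    refine (e1.fun_mul e2).congr_deriv ?_
    rw [hu]
    push_cast
    ring
  · intro x hx
    refine (norm_mul_kern_le _ _ _ (fun i => (hx i).le) hs).trans ?_
    rw [prod_pow_add_single, mul_assoc, mul_left_comm C]
    refine mul_le_mul_of_nonneg_left ((hC x hx).trans ?_) (hx i).le
    refine mul_le_mul_of_nonneg_left ?_ hC0
    rw [← Finset.mul_prod_erase _ _ (mem_univ i)]
    refine mul_le_of_le_one_right (by positivity) (Finset.prod_le_one (fun l _ => by positivity)
      fun l _ => inv_le_one_of_one_le₀ (by nlinarith [sq_nonneg (x l)]))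

lemma hankelC_raise (hG : IsFam G) (hR : IsRapid G) (q m p : Fin d → ℕ) (i : Fin d)
    {s : Fin d → ℝ} (hs : ∀ i, 0 ≤ s i) :
    hankelC (G q) m p s = ((p i : ℂ) - m i) * hankelC (G q) m (p + Pi.single i 1) s -
      hankelC (G (q + Pi.single i 1)) (m + Pi.single i 1) (p + Pi.single i 1) s := by
  have h1 : hankelC (G q) m p s = (p i + 1) * hankelC (G q) m (p + Pi.single i 1) s -
      s i * hankelC (G q) (m + Pi.single i 1) (p + Pi.single i 2) s := by
    unfold hankelC
    rw [← integral_const_mul, ← integral_const_mul, ← integral_sub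
      ((integrable_mul_kern hG hR _ _ _ hs).const_mul _)
      ((integrable_mul_kern hG hR _ _ _ hs).const_mul _)]
    refine integral_congr_ae (ae_of_all _ fun x => ?_)
    simp only []
    rw [kern_recurrence m p i x s]
    push_cast
    ring
  have h2 := hankelC_by_parts hG hR q m (p + Pi.single i 1) i hs
  rw [add_assoc, ← Pi.single_add] at h2
  rw [h1, h2]
  ring

lemma hankelC_raise_self (hG : IsFam G) (hR : IsRapid G) (q p k : Fin d → ℕ)
    {s : Fin d → ℝ} (hs : ∀ i, 0 ≤ s i) :
    hankelC (G q) p p s =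
      (∏ i, (-1 : ℂ) ^ k i) * hankelC (G (q + k)) (p + k) (p + k) s := by
  induction hN : ∑ i, k i generalizing k with
  | zero =>
    have : k = 0 := by
      ext i
      exact (Finset.sum_eq_zero_iff.1 hN) i (mem_univ i)
    simp [this]
  | succ N ih =>
    obtain ⟨i, -, hi⟩ : ∃ i ∈ univ, k i ≠ 0 := Finset.exists_ne_zero_of_sum_ne_zero (by omega)
    obtain ⟨k', rfl⟩ : ∃ k', k = k' + Pi.single i 1 := by
      refine ⟨k - Pi.single i 1, (tsub_add_cancel_of_le fun l => ?_).symm⟩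
      by_cases hl : l = i
      · subst hl; simp; omega
      · simp [hl]
    have hN' : ∑ i, k' i = N := by
      simp only [Pi.add_apply, Finset.sum_add_distrib, Finset.sum_pi_single', mem_univ,
        if_true] at hN
      simpa using hN
    have h := hankelC_raise hG hR (q + k') (p + k') (p + k') i hs
    rw [sub_self, zero_mul, zero_sub] at h
    rw [ih k' hN', h]
    simp only [Pi.add_apply, pow_add, Finset.prod_mul_distrib]
    rw [Finset.prod_eq_single (f := fun l => (-1 : ℂ) ^ (Pi.single i 1 : Fin d → ℕ) l) i
      (fun l _ hl => by simp [hl]) (by simp)]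
    simp only [← add_assoc]
    simp

lemma mul_hankelC (hG : IsFam G) (hR : IsRapid G) (q m p : Fin d → ℕ) (i : Fin d)
    (hpm : p i ≤ m i) {s : Fin d → ℝ} (hs : ∀ i, 0 ≤ s i) :
    s i * hankelC (G q) m p s =
      ((p i : ℂ) - m i) * (hankelC (G (q + Pi.single i 1)) m p s +
        m i * hankelC (G q) (m - Pi.single i 1) p s) -
      (hankelC (G (q + Pi.single i 1 + Pi.single i 1)) (m + Pi.single i 1) p s +
        (m i + 1) * hankelC (G (q + Pi.single i 1)) m p s) := by
  rw [hankelC_raise hG hR q m p i hs, mul_sub,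
    hankelC_by_parts hG hR (q + Pi.single i 1) m p i hs]
  congr 1
  rcases hpm.eq_or_lt with h | h
  · simp [h]
  · obtain ⟨m', rfl⟩ : ∃ m', m = m' + Pi.single i 1 := by
      refine ⟨m - Pi.single i 1, (tsub_add_cancel_of_le fun l => ?_).symm⟩
      by_cases hl : l = i
      · subst hl; simp; omega
      · simp [hl]
    rw [mul_left_comm, hankelC_by_parts hG hR q m' p i hs]
    simp

lemma exists_decay_hankelC (hG : IsFam G) (hR : IsRapid G) (k q m p : Fin d → ℕ) (hpm : p ≤ m) :
    ∃ C, ∀ s ∈ Rpos d, (∏ i, s i ^ k i) * ‖hankelC (G q) m p s‖ ≤ C := by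
  induction hN : ∑ i, k i generalizing k q m with
  | zero =>
    have : k = 0 := by
      ext i
      exact (Finset.sum_eq_zero_iff.1 hN) i (mem_univ i)
    simpa [this] using exists_norm_hankelC_le hG hR q m p
  | succ N ih =>
    obtain ⟨i, -, hi⟩ : ∃ i ∈ univ, k i ≠ 0 := Finset.exists_ne_zero_of_sum_ne_zero (by omega)
    obtain ⟨k', rfl⟩ : ∃ k', k = k' + Pi.single i 1 := by
      refine ⟨k - Pi.single i 1, (tsub_add_cancel_of_le fun l => ?_).symm⟩
      by_cases hl : l = i
      · subst hl; simp; omega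
      · simp [hl]
    have hN' : ∑ i, k' i = N := by
      simp only [Pi.add_apply, Finset.sum_add_distrib, Finset.sum_pi_single', mem_univ,
        if_true] at hN
      simpa using hN
    have hpm1 : p ≤ m + Pi.single i 1 := hpm.trans le_self_add
    obtain ⟨C1, h1⟩ := ih k' (q + Pi.single i 1) m hpm hN'
    obtain ⟨C2, h2⟩ := ih k' (q + Pi.single i 1 + Pi.single i 1) _ hpm1 hN'
    obtain ⟨C3, h3⟩ : ∃ C, ∀ s ∈ Rpos d, (∏ i, s i ^ k' i) *
        ‖((p i : ℂ) - m i) * (m i * hankelC (G q) (m - Pi.single i 1) p s)‖ ≤ C := by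
      rcases Nat.eq_or_lt_of_le (hpm i) with h | h
      · exact ⟨0, fun s _ => by simp [h]⟩
      · obtain ⟨C, hC⟩ := ih k' q (m - Pi.single i 1) (fun l => by
          by_cases hl : l = i
          · subst hl; simp; omega
          · simpa [hl] using hpm l) hN'
        refine ⟨‖((p i : ℂ) - m i) * m i‖ * C, fun s hs => ?_⟩
        rw [← mul_assoc, norm_mul, mul_left_comm]
        exact mul_le_mul_of_nonneg_left (hC s hs) (norm_nonneg _)
    refine ⟨‖(p i : ℂ) - m i‖ * C1 + C3 + C2 + ‖(m i : ℂ) + 1‖ * C1, fun s hs => ?_⟩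
    have hP : 0 ≤ ∏ i, s i ^ k' i := Finset.prod_nonneg fun l _ => pow_nonneg (hs l).le _
    have hsi : ‖hankelC (G q) m p s‖ * s i = ‖s i * hankelC (G q) m p s‖ := by
      rw [norm_mul, Complex.norm_real, Real.norm_of_nonneg (hs i).le, mul_comm]
    rw [prod_pow_add_single, mul_comm (s i), mul_assoc, mul_comm (s i), hsi,
      mul_hankelC hG hR q m p i (hpm i) fun i => (hs i).le]
    refine (mul_le_mul_of_nonneg_left ((norm_sub_le _ _).trans (add_le_add
      ((congrArg norm (mul_add _ _ _)).le.trans (norm_add_le _ _)) (norm_add_le _ _))) hP).trans ?_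
    have e1 := mul_le_mul_of_nonneg_left (h1 s hs) (norm_nonneg ((p i : ℂ) - m i))
    have e2 := mul_le_mul_of_nonneg_left (h1 s hs) (norm_nonneg ((m i : ℂ) + 1))
    have e3 := h2 s hs
    have e4 := h3 s hs
    rw [norm_mul ((p i : ℂ) - m i) (hankelC _ _ _ _), norm_mul ((m i : ℂ) + 1)]
    linarith

end Parts

section Transform
variable {d : ℕ}

/-- The dilation factors `|1 - z_l|⁻²`. -/
def scal (z : Fin d → ℂ) : Fin d → ℝ := fun l => (‖1 - z l‖ ^ 2)⁻¹

lemma div_one_sub_sq {z : ℂ} (hz : ‖z‖ = 1) (hz1 : z ≠ 1) :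
    z / (1 - z) ^ 2 = -(((‖1 - z‖ ^ 2)⁻¹ : ℝ) : ℂ) := by
  have h0 : z ≠ 0 := fun h => by simp [h] at hz
  have h1 : 1 - z ≠ 0 := sub_ne_zero.2 hz1.symm
  have h2 : starRingEnd ℂ z * z = 1 := by
    rw [mul_comm, Complex.mul_conj, Complex.normSq_eq_norm_sq, hz]; simp
  have h3 : ((‖1 - z‖ ^ 2 : ℝ) : ℂ) = (1 - z) * (1 - starRingEnd ℂ z) := by
    rw [← Complex.normSq_eq_norm_sq, ← Complex.mul_conj]; simp
  have h5 : ((‖1 - z‖ ^ 2 : ℝ) : ℂ) ≠ 0 :=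
    Complex.ofReal_ne_zero.2 (pow_ne_zero _ (norm_ne_zero_iff.2 h1))
  rw [Complex.ofReal_inv]
  field_simp
  rw [h3]
  linear_combination -(1 - z) * h2

lemma scal_pos {z : Fin d → ℂ} (hz : ∀ l, ‖z l‖ = 1 ∧ z l ≠ 1) (l : Fin d) : 0 < scal z l :=
  inv_pos.2 (pow_pos (norm_pos_iff.2 (sub_ne_zero.2 (hz l).2.symm)) _)

lemma J0_eq {z : Fin d → ℂ} (hz : ∀ l, ‖z l‖ = 1 ∧ z l ≠ 1) (f : (Fin d → ℝ) → ℂ)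
    (t : Fin d → ℝ) :
    J0 z f t = (∏ l, (1 - z l)⁻¹) * hankelC f 0 0 (scal z * t) := by
  unfold J0 hankelC kern
  congr 2
  ext x
  rw [Complex.ofReal_prod]
  congr 1
  refine Finset.prod_congr rfl fun l _ => ?_
  rw [mul_div_assoc, div_one_sub_sq (hz l).1 (hz l).2, Pi.zero_apply, pow_zero, one_mul,
    ← K0_neg_ofReal]
  congr 1
  simp only [Pi.mul_apply, scal]
  push_cast
  ring

/-- The derivatives of `c · hankelC (G 0) 0 0 (a t)`. -/
def hankelFam (c : ℂ) (a : Fin d → ℝ) (F : (Fin d → ℝ) → ℂ) (q : Fin d → ℕ) (t : Fin d → ℝ) : ℂ :=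
  c * (∏ l, (-(a l : ℂ)) ^ q l) * hankelC F q q (a * t)

lemma mul_mem_Rpos {a t : Fin d → ℝ} (ha : ∀ l, 0 < a l) (ht : t ∈ Rpos d) : a * t ∈ Rpos d :=
  fun l => mul_pos (ha l) (ht l)

variable {G : (Fin d → ℕ) → (Fin d → ℝ) → ℂ}

lemma isFam_hankelFam (hG : IsFam G) (hR : IsRapid G) (c : ℂ) {a : Fin d → ℝ}
    (ha : ∀ l, 0 < a l) : IsFam (hankelFam c a (G 0)) := by
  intro q t ht
  have hlin : HasFDerivAt (fun t : Fin d → ℝ => a * t)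
      (ContinuousLinearMap.pi fun i => a i • ContinuousLinearMap.proj (R := ℝ)
        (φ := fun _ : Fin d => ℝ) i) t :=
    hasFDerivAt_pi.2 fun i => (hasFDerivAt_apply i t).const_mul (a i)
  refine (((hasFDerivAt_hankelC hG hR 0 q q (mul_mem_Rpos ha ht)).comp t hlin).const_mul
    (c * ∏ l, (-(a l : ℂ)) ^ q l)).congr_fderiv ?_
  ext v
  simp only [_root_.smul_apply, ContinuousLinearMap.comp_apply,
    _root_.sum_apply, ContinuousLinearMap.smulRight_apply, ContinuousLinearMap.coe_pi',
    ContinuousLinearMap.proj_apply, smul_eq_mul, Complex.real_smul, hankelFam, Finset.mul_sum]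
  refine Finset.sum_congr rfl fun i _ => ?_
  have : ∏ l, (-(a l : ℂ)) ^ (q + Pi.single i 1 : Fin d → ℕ) l =
      (∏ l, (-(a l : ℂ)) ^ q l) * -(a i : ℂ) := by
    simp only [Pi.add_apply, pow_add, Finset.prod_mul_distrib]
    congr 1
    rw [Finset.prod_eq_single i (fun b _ hb => by simp [Pi.single_eq_of_ne hb]) (by simp)]
    simp
  rw [this]
  push_cast
  ring

lemma isRapid_hankelFam (hG : IsFam G) (hR : IsRapid G) (c : ℂ) {a : Fin d → ℝ}
    (ha : ∀ l, 0 < a l) : IsRapid (hankelFam c a (G 0)) := by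
  intro k q
  obtain ⟨C, hC⟩ := exists_decay_hankelC hG hR k 0 q q le_rfl
  refine ⟨(∏ l, a l ^ k l)⁻¹ * ‖c * ∏ l, (-(a l : ℂ)) ^ q l‖ * C, fun t ht => ?_⟩
  have h1 : 0 < ∏ l, a l ^ k l := Finset.prod_pos fun l _ => pow_pos (ha l) _
  have h2 := hC _ (mul_mem_Rpos ha ht)
  simp only [Pi.mul_apply, mul_pow, Finset.prod_mul_distrib] at h2
  have h3 : (∏ l, t l ^ k l) * ‖hankelFam c a (G 0) q t‖ =
      (∏ l, a l ^ k l)⁻¹ * ‖c * ∏ l, (-(a l : ℂ)) ^ q l‖ *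
        ((∏ l, a l ^ k l) * (∏ l, t l ^ k l) * ‖hankelC (G 0) q q (a * t)‖) := by
    rw [hankelFam, norm_mul]
    field_simp
  rw [h3]
  exact mul_le_mul_of_nonneg_left h2 (by positivity)

lemma continuousOn_hankelFam (hG : IsFam G) (hR : IsRapid G) (c : ℂ) {a : Fin d → ℝ}
    (ha : ∀ l, 0 < a l) (q : Fin d → ℕ) :
    ContinuousOn (hankelFam c a (G 0) q) {t | ∀ i, 0 ≤ t i} := by
  refine continuousOn_const.mul ((continuousOn_hankelC hG hR 0 q q).comp
    (by fun_prop : Continuous fun t : Fin d → ℝ => a * t).continuousOn ?_)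
  exact fun t ht i => mul_nonneg (ha i).le (ht i)

lemma hankelFam_J0 {z : Fin d → ℂ} (hz : ∀ l, ‖z l‖ = 1 ∧ z l ≠ 1) (f : (Fin d → ℝ) → ℂ) :
    hankelFam (∏ l, (1 - z l)⁻¹) (scal z) f 0 = J0 z f := by
  ext t
  rw [J0_eq hz]
  simp [hankelFam]

end Transform

section Laplace
variable {d : ℕ}

/-- The bounded function `y ↦ exp (-∑ n_l y_l)` on the closed orthant. -/
def expBdd (n : Fin d → ℕ) : BoundedContinuousFunction (Fin d → NNReal) ℝ :=
  BoundedContinuousFunction.ofNormedAddCommGroup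
    (fun y => Real.exp (-∑ l, (n l : ℝ) * (y l : ℝ))) (by fun_prop) 1 fun y => by
      rw [Real.norm_of_nonneg (Real.exp_pos _).le, Real.exp_le_one_iff, neg_nonpos]
      exact Finset.sum_nonneg fun l _ => by positivity

lemma expBdd_apply (n : Fin d → ℕ) (y : Fin d → NNReal) :
    expBdd n y = Real.exp (-∑ l, (n l : ℝ) * (y l : ℝ)) := rfl

/-- The exponentials form a submonoid of the bounded continuous functions. -/
def expSubmonoid (d : ℕ) : Submonoid (BoundedContinuousFunction (Fin d → NNReal) ℝ) where
  carrier := Set.range expBdd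
  one_mem' := ⟨0, by ext y; simp [expBdd_apply]⟩
  mul_mem' := by
    rintro _ _ ⟨m, rfl⟩ ⟨n, rfl⟩
    refine ⟨m + n, ?_⟩
    ext y
    rw [BoundedContinuousFunction.mul_apply, expBdd_apply, expBdd_apply, expBdd_apply,
      ← Real.exp_add, ← neg_add, ← Finset.sum_add_distrib]
    simp [add_mul]

/-- The star algebra spanned by the exponentials. -/
def expAlgebra (d : ℕ) : StarSubalgebra ℝ (BoundedContinuousFunction (Fin d → NNReal) ℝ) :=
  { Algebra.adjoin ℝ (expSubmonoid d : Set (BoundedContinuousFunction (Fin d → NNReal) ℝ)) with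
    star_mem' := fun {a} ha => by
      have : star a = a := by ext; simp
      rwa [this] }

lemma measure_ext_of_laplace {P P' : Measure (Fin d → NNReal)} [IsFiniteMeasure P]
    [IsFiniteMeasure P'] (h : ∀ n : Fin d → ℕ, ∫ y, expBdd n y ∂P = ∫ y, expBdd n y ∂P') :
    P = P' := by
  refine ext_of_forall_mem_subalgebra_integral_eq_of_polish (𝕜 := ℝ) (A := expAlgebra d) ?_ ?_
  · intro y y' hne
    obtain ⟨i, hi⟩ := Function.ne_iff.1 hne
    refine ⟨_, ⟨_, ⟨expBdd (Pi.single i 1), ?_, rfl⟩, rfl⟩, ?_⟩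
    · exact Algebra.subset_adjoin ⟨_, rfl⟩
    · have : ∀ y : Fin d → NNReal, expBdd (Pi.single i 1) y = Real.exp (-(y i : ℝ)) := fun y => by
        rw [expBdd_apply]
        simp [Pi.single_apply]
      intro heq
      have heq' : expBdd (Pi.single i 1) y = expBdd (Pi.single i 1) y' := heq
      rw [this, this, Real.exp_eq_exp, neg_inj, NNReal.coe_inj] at heq'
      exact hi heq'
  · intro g hg
    have hg' : g ∈ Subalgebra.toSubmodule (Algebra.adjoin ℝ
      (expSubmonoid d : Set (BoundedContinuousFunction (Fin d → NNReal) ℝ))) := hg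
    rw [Algebra.adjoin_eq_span, Submonoid.closure_eq] at hg'
    clear hg
    induction hg' using Submodule.span_induction with
    | mem g hg => obtain ⟨n, rfl⟩ := hg; exact h n
    | zero => simp
    | add a b _ _ iha ihb =>
      simp only [BoundedContinuousFunction.add_apply]
      rw [integral_add (a.integrable P) (b.integrable P),
        integral_add (a.integrable P') (b.integrable P'), iha, ihb]
    | smul c a _ iha =>
      simp only [BoundedContinuousFunction.smul_apply, smul_eq_mul]
      rw [integral_const_mul, integral_const_mul, iha]

lemma ae_eq_zero_of_laplace {w : (Fin d → ℝ) → ℝ} (hw : IntegrableOn w (Rpos d))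
    (h : ∀ n : Fin d → ℕ, ∫ x in Rpos d, Real.exp (-∑ l, (n l : ℝ) * x l) * w x = 0) :
    w =ᵐ[volume.restrict (Rpos d)] 0 := by
  set μ := volume.restrict (Rpos d)
  let T : (Fin d → ℝ) → (Fin d → NNReal) := fun x l => (x l).toNNReal
  let T' : (Fin d → NNReal) → (Fin d → ℝ) := fun y l => (y l : ℝ)
  have hT : Measurable T := by fun_prop
  have hT' : Measurable T' := by fun_prop
  have hTT : ∀ᵐ x ∂μ, T' (T x) = x := (ae_restrict_mem measurableSet_Rpos).mono fun x hx => by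
    ext l
    exact Real.coe_toNNReal _ (hx l).le
  have := isFiniteMeasure_withDensity_ofReal hw.2
  have := isFiniteMeasure_withDensity_ofReal hw.neg.2
  have hint : ∀ v : (Fin d → ℝ) → ℝ, Integrable v μ → ∀ n : Fin d → ℕ,
      ∫ y, expBdd n y ∂((μ.withDensity fun x => ENNReal.ofReal (v x)).map T) =
        ∫ x, max (v x) 0 * Real.exp (-∑ l, (n l : ℝ) * x l) ∂μ := by
    intro v hv n
    rw [integral_map hT.aemeasurable (expBdd n).continuous.aestronglyMeasurable,
      integral_withDensity_eq_integral_toReal_smul₀ hv.aestronglyMeasurable.aemeasurable.ennreal_ofReal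
        (ae_of_all _ fun _ => ENNReal.ofReal_lt_top)]
    refine integral_congr_ae (hTT.mono fun x hx => ?_)
    simp only [smul_eq_mul, ENNReal.toReal_ofReal', expBdd_apply]
    congr 4
    ext l
    exact congrArg _ (congrFun hx l)
  have hP : (μ.withDensity fun x => ENNReal.ofReal (w x)).map T =
      (μ.withDensity fun x => ENNReal.ofReal ((-w) x)).map T := by
    refine measure_ext_of_laplace fun n => ?_
    rw [hint w hw n, hint (-w) hw.neg n, ← sub_eq_zero, ← integral_sub]
    · refine (integral_congr_ae (ae_of_all _ fun x => ?_)).trans (h n)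
      simp only [Pi.neg_apply]
      rw [← sub_mul, mul_comm]
      congr 1
      rcases le_total (w x) 0 with h0 | h0
      · rw [max_eq_right h0, max_eq_left (neg_nonneg.2 h0)]; ring
      · rw [max_eq_left h0, max_eq_right (neg_nonpos.2 h0)]; ring
    all_goals
      refine Integrable.mul_bdd (c := 1) ?_ (Continuous.aestronglyMeasurable (by fun_prop))
        ((ae_restrict_mem measurableSet_Rpos).mono fun x hx => ?_)
      · first | exact hw.pos_part | exact hw.neg.pos_part
      · rw [Real.norm_of_nonneg (Real.exp_pos _).le, Real.exp_le_one_iff, neg_nonpos]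
        exact Finset.sum_nonneg fun l _ => mul_nonneg (Nat.cast_nonneg _) (hx l).le
  have hback : ∀ v : (Fin d → ℝ) → ℝ,
      ((μ.withDensity fun x => ENNReal.ofReal (v x)).map T).map T' =
        μ.withDensity fun x => ENNReal.ofReal (v x) := by
    intro v
    rw [Measure.map_map hT' hT]
    conv_rhs => rw [← Measure.map_id (μ := μ.withDensity fun x => ENNReal.ofReal (v x))]
    exact Measure.map_congr ((withDensity_absolutelyContinuous μ _).ae_le hTT)
  have heq := congrArg (Measure.map T') hP
  rw [hback, hback, withDensity_eq_iff hw.aestronglyMeasurable.aemeasurable.ennreal_ofReal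
    hw.neg.aestronglyMeasurable.aemeasurable.ennreal_ofReal
    ((lintegral_ofReal_le_lintegral_enorm w).trans_lt hw.2).ne] at heq
  refine heq.mono fun x hx => ?_
  simp only [Pi.neg_apply] at hx
  rcases le_total (w x) 0 with h0 | h0
  · rw [ENNReal.ofReal_of_nonpos h0, eq_comm, ENNReal.ofReal_eq_zero] at hx
    exact le_antisymm h0 (by simpa using hx)
  · rw [ENNReal.ofReal_of_nonpos (neg_nonpos.2 h0), ENNReal.ofReal_eq_zero] at hx
    exact le_antisymm hx h0

lemma integrable_exp_mul {h : (Fin d → ℝ) → ℂ} (hi : IntegrableOn h (Rpos d)) {s : Fin d → ℝ}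
    (hs : ∀ i, 0 ≤ s i) :
    IntegrableOn (fun x => (Real.exp (-∑ l, s l * x l) : ℂ) * h x) (Rpos d) := by
  refine Integrable.bdd_mul (c := 1) hi (Continuous.aestronglyMeasurable (by fun_prop))
    ((ae_restrict_mem measurableSet_Rpos).mono fun x hx => ?_)
  rw [Complex.norm_real, Real.norm_of_nonneg (Real.exp_pos _).le, Real.exp_le_one_iff, neg_nonpos]
  exact Finset.sum_nonneg fun l _ => mul_nonneg (hs l) (hx l).le

/-- Uniqueness for the Laplace transform on the orthant. -/
lemma eqOn_zero_of_laplace {h : (Fin d → ℝ) → ℂ} (hc : ContinuousOn h (Rpos d))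
    (hi : IntegrableOn h (Rpos d))
    (hL : ∀ s ∈ Rpos d, ∫ x in Rpos d, (Real.exp (-∑ l, s l * x l) : ℂ) * h x = 0) :
    Set.EqOn h 0 (Rpos d) := by
  have hone := integrable_exp_mul hi (s := fun _ => 1) fun _ => zero_le_one
  have key : ∀ n : Fin d → ℕ, ∀ x : Fin d → ℝ, Real.exp (-∑ l, ((n l : ℝ) + 1) * x l) =
      Real.exp (-∑ l, (n l : ℝ) * x l) * Real.exp (-∑ l, 1 * x l) := fun n x => by
    rw [← Real.exp_add, ← neg_add, ← Finset.sum_add_distrib]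
    simp [add_mul]
  have hs : ∀ n : Fin d → ℕ, (fun l => (n l : ℝ) + 1) ∈ Rpos d := fun n l => by positivity
  have hint := fun n => integrable_exp_mul hi (s := fun l => (n l : ℝ) + 1) fun l => (hs n l).le
  have hre := ae_eq_zero_of_laplace hone.re fun n => by
    have h1 := congrArg RCLike.re (hL _ (hs n))
    rw [← integral_re (hint n)] at h1
    refine (integral_congr_ae (ae_of_all _ fun x => ?_)).trans (h1.trans (map_zero RCLike.re))
    simp only [key]
    rw [Complex.ofReal_mul, mul_assoc]
    exact (Complex.re_ofReal_mul _ _).symm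
  have him := ae_eq_zero_of_laplace hone.im fun n => by
    have h1 := congrArg RCLike.im (hL _ (hs n))
    rw [← integral_im (hint n)] at h1
    refine (integral_congr_ae (ae_of_all _ fun x => ?_)).trans (h1.trans (map_zero RCLike.im))
    simp only [key]
    rw [Complex.ofReal_mul, mul_assoc]
    exact (Complex.im_ofReal_mul _ _).symm
  refine Measure.eqOn_open_of_ae_eq (μ := volume) ?_ isOpen_Rpos hc continuousOn_const
  filter_upwards [hre, him] with x h1 h2
  have h3 : (Real.exp (-∑ l, 1 * x l) : ℂ) * h x = 0 := Complex.ext h1 h2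
  exact (mul_eq_zero.1 h3).resolve_left (Complex.ofReal_ne_zero.2 (Real.exp_pos _).ne')

end Laplace

section Inversion
variable {d : ℕ}

lemma prod_pow_mul_kern_symm (m p : Fin d → ℕ) (a x t : Fin d → ℝ) :
    (∏ l, t l ^ m l) * kern m p x (a * t) = (∏ l, x l ^ m l) * kern m p t (a * x) := by
  unfold kern
  rw [← Finset.prod_mul_distrib, ← Finset.prod_mul_distrib]
  refine Finset.prod_congr rfl fun l _ => ?_
  simp only [Pi.mul_apply]
  rw [show x l * (a l * t l) = t l * (a l * x l) by ring]
  ring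

/-- Fubini's theorem for the symmetric kernels. -/
lemma hankelC_swap {u v : (Fin d → ℝ) → ℂ} {m : Fin d → ℕ} {a : Fin d → ℝ} (ha : ∀ l, 0 < a l)
    (hu : ContinuousOn u (Rpos d)) (hv : ContinuousOn v (Rpos d))
    (iu : IntegrableOn (fun x => (∏ l, x l ^ m l) * ‖u x‖) (Rpos d))
    (iv : IntegrableOn (fun x => (∏ l, x l ^ m l) * ‖v x‖) (Rpos d)) :
    ∫ t in Rpos d, ((∏ l, t l ^ m l : ℝ) : ℂ) * v t * hankelC u m m (a * t) =
      ∫ x in Rpos d, ((∏ l, x l ^ m l : ℝ) : ℂ) * u x * hankelC v m m (a * x) := by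
  unfold hankelC
  simp only [← integral_const_mul]
  rw [integral_integral_swap]
  · refine integral_congr_ae (ae_of_all _ fun x => integral_congr_ae (ae_of_all _ fun t => ?_))
    have h := congrArg (fun r : ℝ => (r : ℂ)) (prod_pow_mul_kern_symm m m a x t)
    simp only [Complex.ofReal_mul] at h
    linear_combination (v t * u x) * h
  · refine (iv.mul_prod iu).mono' ?_ ?_
    · rw [Measure.prod_restrict, ← Measure.volume_eq_prod]
      refine ContinuousOn.aestronglyMeasurable ?_ (measurableSet_Rpos.prod measurableSet_Rpos)
      have h1 : ContinuousOn (fun y : (Fin d → ℝ) × (Fin d → ℝ) => v y.1) (Rpos d ×ˢ Rpos d) :=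
        hv.comp continuous_fst.continuousOn fun y hy => hy.1
      have h2 : ContinuousOn (fun y : (Fin d → ℝ) × (Fin d → ℝ) => u y.2) (Rpos d ×ˢ Rpos d) :=
        hu.comp continuous_snd.continuousOn fun y hy => hy.2
      have h3 : Continuous fun y : (Fin d → ℝ) × (Fin d → ℝ) =>
          (kern m m y.2 (a * y.1) : ℂ) :=
        Complex.continuous_ofReal.comp ((continuous_kern m m).comp
          (by fun_prop : Continuous fun y : (Fin d → ℝ) × (Fin d → ℝ) => (y.2, a * y.1)))
      have h4 : Continuous fun y : (Fin d → ℝ) × (Fin d → ℝ) =>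
          ((∏ l, y.1 l ^ m l : ℝ) : ℂ) := by fun_prop
      exact (h4.continuousOn.mul h1).mul (h2.mul h3.continuousOn)
    · rw [Measure.prod_restrict]
      refine (ae_restrict_mem (measurableSet_Rpos.prod measurableSet_Rpos)).mono fun y hy => ?_
      simp only [Function.uncurry]
      rw [norm_mul, norm_mul, Complex.norm_real,
        Real.norm_of_nonneg (Finset.prod_nonneg fun l _ => pow_nonneg (hy.1 l).le _)]
      exact mul_le_mul_of_nonneg_left (norm_mul_kern_le _ _ _ (fun i => (hy.2 i).le)
        fun i => (mul_mem_Rpos ha hy.1 i).le)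
        (mul_nonneg (Finset.prod_nonneg fun l _ => pow_nonneg (hy.1 l).le _) (norm_nonneg _))

lemma restrict_Rpos : (volume : Measure (Fin d → ℝ)).restrict (Rpos d) =
    Measure.pi fun _ => (volume : Measure ℝ).restrict (Set.Ioi 0) := by
  have : Rpos d = Set.univ.pi fun _ => Set.Ioi (0 : ℝ) := by ext; simp [Rpos]
  rw [this, volume_pi, Measure.restrict_pi_pi]

lemma integrableOn_exp_neg_sum {s : Fin d → ℝ} (hs : s ∈ Rpos d) :
    IntegrableOn (fun x : Fin d → ℝ => Real.exp (-∑ l, s l * x l)) (Rpos d) := by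
  rw [IntegrableOn, restrict_Rpos]
  refine (Integrable.fintype_prod (f := fun l (y : ℝ) => Real.exp (-(s l * y)))
    fun l => integrableOn_exp_neg (hs l)).congr (ae_of_all _ fun x => ?_)
  simp only
  rw [← Real.exp_sum, Finset.sum_neg_distrib]

lemma hankelC_exp {s t : Fin d → ℝ} (hs : s ∈ Rpos d) (ht : t ∈ Rpos d) :
    hankelC (fun x => (Real.exp (-∑ l, s l * x l) : ℂ)) 0 0 t =
      ((∏ l, (s l)⁻¹ : ℝ) : ℂ) * (Real.exp (-∑ l, (s l)⁻¹ * t l) : ℂ) := by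
  unfold hankelC
  have h : ∀ x, (Real.exp (-∑ l, s l * x l) : ℂ) * (kern 0 0 x t : ℂ) =
      ((∏ l, Real.exp (-(s l * x l)) * besselC 0 (x l * t l) : ℝ) : ℂ) := fun x => by
    rw [← Complex.ofReal_mul, Finset.prod_mul_distrib, ← Real.exp_sum, Finset.sum_neg_distrib]
    simp [kern]
  simp only [h]
  rw [integral_complex_ofReal, restrict_Rpos, integral_fintype_prod_eq_prod
    (f := fun l y => Real.exp (-(s l * y)) * besselC 0 (y * t l))]
  simp only [integral_exp_mul_besselC (hs _) (ht _).le]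
  rw [Finset.prod_mul_distrib, ← Real.exp_sum, Finset.sum_neg_distrib, Complex.ofReal_mul]

variable {G : (Fin d → ℕ) → (Fin d → ℝ) → ℂ}

lemma IsRapid.integrableOn (hG : IsFam G) (hR : IsRapid G) : IntegrableOn (G 0) (Rpos d) := by
  have h := integrable_bound hG hR 0 0
  simp only [Pi.zero_apply, pow_zero, Finset.prod_const_one, one_mul] at h
  exact (integrable_norm_iff
    ((hG.continuousOn 0).aestronglyMeasurable measurableSet_Rpos)).1 h

lemma laplace_hankelC (hG : IsFam G) (hR : IsRapid G) {a s : Fin d → ℝ} (ha : ∀ l, 0 < a l)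
    (hs : s ∈ Rpos d) :
    ∫ x in Rpos d, (Real.exp (-∑ l, s l * x l) : ℂ) * hankelC (G 0) 0 0 (a * x) =
      ((∏ l, (s l)⁻¹ : ℝ) : ℂ) *
        ∫ x in Rpos d, (Real.exp (-∑ l, (a l / s l) * x l) : ℂ) * G 0 x := by
  have h := hankelC_swap (m := 0) ha (hG.continuousOn 0)
    (v := fun x => (Real.exp (-∑ l, s l * x l) : ℂ)) (Continuous.continuousOn (by fun_prop))
    (integrable_bound hG hR 0 0) (by
      simpa [← Complex.ofReal_exp, -Complex.ofReal_exp] using integrableOn_exp_neg_sum hs)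
  simp only [Pi.zero_apply, pow_zero, Finset.prod_const_one, Complex.ofReal_one, one_mul] at h
  rw [h, ← integral_const_mul]
  refine setIntegral_congr_fun measurableSet_Rpos fun x hx => ?_
  rw [hankelC_exp hs (mul_mem_Rpos ha hx)]
  have : ∀ l, (s l)⁻¹ * (a * x) l = a l / s l * x l := fun l => by
    rw [Pi.mul_apply, div_eq_inv_mul, mul_assoc]
  simp only [this]
  ring

lemma hankelFam_inversion (hG : IsFam G) (hR : IsRapid G) {a : Fin d → ℝ} (ha : ∀ l, 0 < a l)
    {c c' : ℂ} (hc : c' * c = ((∏ l, a l : ℝ) : ℂ)) :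
    Set.EqOn (hankelFam c' a (hankelFam c a (G 0) 0) 0) (G 0) (Rpos d) := by
  have hG1 := isFam_hankelFam hG hR c ha
  have hR1 := isRapid_hankelFam hG hR c ha
  have hG2 := isFam_hankelFam hG1 hR1 c' ha
  have hR2 := isRapid_hankelFam hG1 hR1 c' ha
  have i2 := IsRapid.integrableOn hG2 hR2
  have i0 := IsRapid.integrableOn hG hR
  have hform : ∀ (c : ℂ) (F : (Fin d → ℝ) → ℂ) t, hankelFam c a F 0 t =
    c * hankelC F 0 0 (a * t) := fun c F t => by simp [hankelFam]
  refine fun x hx => sub_eq_zero.1 (eqOn_zero_of_laplace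
    (h := fun x => hankelFam c' a (hankelFam c a (G 0) 0) 0 x - G 0 x)
    ((hG2.continuousOn 0).sub (hG.continuousOn 0)) (i2.sub i0) (fun s hs => ?_) hx)
  have hs' : (fun l => a l / s l) ∈ Rpos d := fun l => div_pos (ha l) (hs l)
  simp only [mul_sub]
  rw [integral_sub (integrable_exp_mul i2 fun i => (hs i).le)
    (integrable_exp_mul i0 fun i => (hs i).le), sub_eq_zero]
  have h1 : ∀ (c : ℂ) (F : (Fin d → ℝ) → ℂ) (s : Fin d → ℝ),
      ∫ x in Rpos d, (Real.exp (-∑ l, s l * x l) : ℂ) * hankelFam c a F 0 x =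
      c * ∫ x in Rpos d, (Real.exp (-∑ l, s l * x l) : ℂ) * hankelC F 0 0 (a * x) :=
    fun c F s => by
      rw [← integral_const_mul]
      refine integral_congr_ae (ae_of_all _ fun x => ?_)
      simp only [hform]
      ring
  rw [h1, laplace_hankelC hG1 hR1 ha hs, h1 c (G 0), laplace_hankelC hG hR ha hs']
  have h2 : ∀ l, a l / (a l / s l) = s l := fun l => by
    rw [div_div_cancel₀ (ha l).ne']
  simp only [h2]
  have h3 : (∏ l, a l) * ((∏ l, (s l)⁻¹) * ∏ l, (a l / s l)⁻¹) = 1 := by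
    rw [← Finset.prod_mul_distrib, ← Finset.prod_mul_distrib]
    refine Finset.prod_eq_one fun l _ => ?_
    have := (ha l).ne'
    have := (hs l).ne'
    field_simp
  have h4 := congrArg (fun r : ℝ => (r : ℂ)) h3
  simp only [Complex.ofReal_mul, Complex.ofReal_one, ← hc] at h4
  linear_combination (∫ x in Rpos d, (Real.exp (-∑ l, s l * x l) : ℂ) * G 0 x) * h4

end Inversion

section Parseval
variable {d : ℕ} {G : (Fin d → ℕ) → (Fin d → ℝ) → ℂ}

lemma hankelC_conj (F : (Fin d → ℝ) → ℂ) (m p : Fin d → ℕ) (s : Fin d → ℝ) :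
    hankelC (fun x => starRingEnd ℂ (F x)) m p s = starRingEnd ℂ (hankelC F m p s) := by
  unfold hankelC
  rw [← integral_conj]
  simp

lemma hankelFam_inversion_deriv (hG : IsFam G) (hR : IsRapid G) {a : Fin d → ℝ}
    (ha : ∀ l, 0 < a l) {c c' : ℂ} (hc : c' * c = ((∏ l, a l : ℝ) : ℂ)) (k : Fin d → ℕ) :
    Set.EqOn (hankelFam c' a (hankelFam c a (G 0) 0) k) (G k) (Rpos d) := by
  have h1 := isFam_hankelFam (isFam_hankelFam hG hR c ha) (isRapid_hankelFam hG hR c ha) c' ha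
  have h2 := hankelFam_inversion hG hR ha hc
  exact fun x hx => (h1.mderiv_eq (Set.eqOn_refl _ _) k hx).symm.trans (hG.mderiv_eq h2 k hx)

/-- A weighted Parseval identity exchanging the roles of derivatives and weights. -/
lemma parseval_hankelFam (hG : IsFam G) (hR : IsRapid G) {a : Fin d → ℝ} (ha : ∀ l, 0 < a l)
    {c : ℂ} (hc : starRingEnd ℂ c * c = ((∏ l, a l : ℝ) : ℂ)) (p k : Fin d → ℕ) :
    (∏ l, a l ^ k l) * ∫ t in Rpos d, (∏ l, t l ^ (p l + k l)) * ‖hankelFam c a (G 0) p t‖ ^ 2 =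
      (∏ l, a l ^ p l) * ∫ x in Rpos d, (∏ l, x l ^ (p l + k l)) * ‖G k x‖ ^ 2 := by
  set H := hankelFam c a (G 0) with hH
  have hG1 : IsFam H := isFam_hankelFam hG hR c ha
  have hR1 : IsRapid H := isRapid_hankelFam hG hR c ha
  have hsw := hankelC_swap (u := G k) (v := fun t => starRingEnd ℂ (H p t)) (m := p + k) ha
    (hG.continuousOn k) (Complex.continuous_conj.comp_continuousOn (hG1.continuousOn p))
    (integrable_bound hG hR k (p + k)) (by
      simpa only [RCLike.norm_conj] using integrable_bound hG1 hR1 p (p + k))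
  have hneg : ∀ q : Fin d → ℕ, (∏ l, (-(a l : ℂ)) ^ q l) =
      (∏ l, (-1 : ℂ) ^ q l) * ((∏ l, a l ^ q l : ℝ) : ℂ) := fun q => by
    push_cast
    rw [← Finset.prod_mul_distrib]
    exact Finset.prod_congr rfl fun l _ => by rw [← mul_pow, neg_one_mul]
  have h1 : ∀ t ∈ Rpos d, H p t = c * (∏ l, (-1 : ℂ) ^ p l) * ((∏ l, a l ^ p l : ℝ) : ℂ) *
      ((∏ l, (-1 : ℂ) ^ k l) * hankelC (G k) (p + k) (p + k) (a * t)) := fun t ht => by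
    have := hankelC_raise_self hG hR 0 p k fun i => (mul_mem_Rpos ha ht i).le
    rw [zero_add] at this
    rw [hH, hankelFam, this, hneg, ← mul_assoc c]
  have h2 : ∀ x ∈ Rpos d, G k x = starRingEnd ℂ c * (∏ l, (-1 : ℂ) ^ k l) *
      ((∏ l, a l ^ k l : ℝ) : ℂ) *
        ((∏ l, (-1 : ℂ) ^ p l) * hankelC (H p) (p + k) (p + k) (a * x)) := fun x hx => by
    have := hankelC_raise_self hG1 hR1 0 k p fun i => (mul_mem_Rpos ha hx i).le
    rw [zero_add, add_comm k p] at this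
    rw [← hankelFam_inversion_deriv hG hR ha hc k hx, hankelFam, this, hneg,
      ← mul_assoc (starRingEnd ℂ c)]
  have h3 : ((∫ t in Rpos d, (∏ l, t l ^ (p l + k l)) * ‖H p t‖ ^ 2 : ℝ) : ℂ) =
      c * (∏ l, (-1 : ℂ) ^ p l) * ((∏ l, a l ^ p l : ℝ) : ℂ) * (∏ l, (-1 : ℂ) ^ k l) *
        ∫ t in Rpos d, ((∏ l, t l ^ (p + k) l : ℝ) : ℂ) * starRingEnd ℂ (H p t) *
          hankelC (G k) (p + k) (p + k) (a * t) := by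
    rw [← integral_complex_ofReal, ← integral_const_mul]
    refine setIntegral_congr_fun measurableSet_Rpos fun t ht => ?_
    simp only [Complex.ofReal_mul, Complex.ofReal_pow, Pi.add_apply]
    rw [← Complex.conj_mul']
    nth_rewrite 2 [h1 t ht]
    ring
  have h5 : ((∏ l, a l ^ k l : ℝ) : ℂ) * (c * (∏ l, (-1 : ℂ) ^ p l) * (∏ l, (-1 : ℂ) ^ k l)) *
      ∫ x in Rpos d, ((∏ l, x l ^ (p + k) l : ℝ) : ℂ) * G k x *
        hankelC (fun t => starRingEnd ℂ (H p t)) (p + k) (p + k) (a * x) =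
      ((∫ x in Rpos d, (∏ l, x l ^ (p l + k l)) * ‖G k x‖ ^ 2 : ℝ) : ℂ) := by
    rw [← integral_complex_ofReal, ← integral_const_mul]
    refine setIntegral_congr_fun measurableSet_Rpos fun x hx => ?_
    simp only [Complex.ofReal_mul, Complex.ofReal_pow, Pi.add_apply]
    rw [← Complex.mul_conj', hankelC_conj]
    have h6 := congrArg (starRingEnd ℂ) (h2 x hx)
    simp only [map_mul, map_prod, map_pow, map_neg, map_one, Complex.conj_ofReal,
      Complex.conj_conj] at h6
    rw [h6]
    ring
  rw [hsw] at h3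
  refine Complex.ofReal_injective ?_
  rw [Complex.ofReal_mul, Complex.ofReal_mul, h3, ← h5]
  ring

end Parseval

section Spaces
variable {d : ℕ}

/-- The seminorm `‖t^{(p+k)/2} D^p f‖` in `L²(ℝ^d₊)`. -/
def gnorm (f : (Fin d → ℝ) → ℂ) (p k : Fin d → ℕ) : ℝ :=
  Real.sqrt (∫ t in Rpos d, ((∏ i, t i ^ (((p i : ℝ) + (k i : ℝ))/2)) * ‖mderiv p f t‖)^2)

lemma gnorm_eq {f : (Fin d → ℝ) → ℂ} {p k : Fin d → ℕ} {g : (Fin d → ℝ) → ℂ}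
    (hg : Set.EqOn (mderiv p f) g (Rpos d)) :
    gnorm f p k = Real.sqrt (∫ t in Rpos d, (∏ l, t l ^ (p l + k l)) * ‖g t‖ ^ 2) := by
  unfold gnorm
  congr 1
  refine setIntegral_congr_fun measurableSet_Rpos fun t ht => ?_
  rw [hg ht, mul_pow, ← Finset.prod_pow]
  congr 1
  refine Finset.prod_congr rfl fun l _ => ?_
  rw [← Real.rpow_natCast, ← Real.rpow_mul (ht l).le, ← Real.rpow_natCast]
  congr 1
  push_cast
  ring

lemma norm_prod_sq (z : Fin d → ℂ) :
    starRingEnd ℂ (∏ l, (1 - z l)⁻¹) * ∏ l, (1 - z l)⁻¹ = ((∏ l, scal z l : ℝ) : ℂ) := by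
  rw [map_prod, ← Finset.prod_mul_distrib, Complex.ofReal_prod]
  refine Finset.prod_congr rfl fun l _ => ?_
  rw [Complex.conj_mul', scal, norm_inv]
  push_cast
  rw [inv_pow]

lemma scal_conj (z : Fin d → ℂ) : scal (fun l => starRingEnd ℂ (z l)) = scal z := by
  ext l
  simp only [scal]
  rw [← RCLike.norm_conj (1 - z l), map_sub, map_one]

lemma IsSPlus.isFam_J0 {f : (Fin d → ℝ) → ℂ} (hf : IsSPlus f) {z : Fin d → ℂ}
    (hz : ∀ l, ‖z l‖ = 1 ∧ z l ≠ 1) :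
    IsFam (hankelFam (∏ l, (1 - z l)⁻¹) (scal z) f) := by
  have h := isFam_hankelFam hf.isFam hf.isRapid (∏ l, (1 - z l)⁻¹) (scal_pos hz)
  rwa [mderiv_zero] at h

lemma IsSPlus.isSPlus_J0 {f : (Fin d → ℝ) → ℂ} (hf : IsSPlus f) {z : Fin d → ℂ}
    (hz : ∀ l, ‖z l‖ = 1 ∧ z l ≠ 1) : IsSPlus (J0 z f) := by
  have h1 := isRapid_hankelFam hf.isFam hf.isRapid (∏ l, (1 - z l)⁻¹) (scal_pos hz)
  have h2 := continuousOn_hankelFam hf.isFam hf.isRapid (∏ l, (1 - z l)⁻¹) (scal_pos hz)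
  rw [mderiv_zero] at h1 h2
  rw [← hankelFam_J0 hz]
  exact (hf.isFam_J0 hz).isSPlus h1 h2

lemma J0_conj_J0 {f : (Fin d → ℝ) → ℂ} (hf : IsSPlus f) {z : Fin d → ℂ}
    (hz : ∀ l, ‖z l‖ = 1 ∧ z l ≠ 1) :
    ∀ t ∈ Rpos d, J0 (fun l => starRingEnd ℂ (z l)) (J0 z f) t = f t := by
  have hz' : ∀ l, ‖starRingEnd ℂ (z l)‖ = 1 ∧ starRingEnd ℂ (z l) ≠ 1 := fun l =>
    ⟨(RCLike.norm_conj _).trans (hz l).1, fun h => (hz l).2 (by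
      simpa using congrArg (starRingEnd ℂ) h)⟩
  have h := hankelFam_inversion hf.isFam hf.isRapid (scal_pos hz) (norm_prod_sq z)
  rw [mderiv_zero, hankelFam_J0 hz] at h
  have hc : starRingEnd ℂ (∏ l, (1 - z l)⁻¹) = ∏ l, (1 - starRingEnd ℂ (z l))⁻¹ := by
    simp [map_prod]
  rw [hc, ← scal_conj, hankelFam_J0 hz'] at h
  exact h

lemma exists_gnorm_J0_le {z : Fin d → ℂ} (hz : ∀ l, ‖z l‖ = 1 ∧ z l ≠ 1) :
    ∃ M : ℝ, 0 < M ∧ ∀ f : (Fin d → ℝ) → ℂ, IsSPlus f → ∀ p k : Fin d → ℕ,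
      gnorm (J0 z f) p k ≤ M ^ (∑ i, (p i + k i)) * gnorm f k p := by
  have ha := scal_pos hz
  refine ⟨1 + ∑ l, (scal z l + (scal z l)⁻¹), ?_, fun f hf p k => ?_⟩
  · exact add_pos_of_pos_of_nonneg one_pos (Finset.sum_nonneg fun l _ =>
      add_nonneg (ha l).le (inv_nonneg.2 (ha l).le))
  set M := 1 + ∑ l, (scal z l + (scal z l)⁻¹) with hM
  have hle : ∀ l, scal z l + (scal z l)⁻¹ ≤ M - 1 := fun l => by
    rw [hM, add_sub_cancel_left]
    exact Finset.single_le_sum (f := fun l => scal z l + (scal z l)⁻¹)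
      (fun l _ => add_nonneg (ha l).le (inv_nonneg.2 (ha l).le)) (mem_univ l)
  have hM1 : 1 ≤ M := by
    rw [hM, le_add_iff_nonneg_right]
    exact Finset.sum_nonneg fun l _ => add_nonneg (ha l).le (inv_nonneg.2 (ha l).le)
  have hMsq : M ≤ M ^ 2 := by nlinarith
  have h1 := parseval_hankelFam hf.isFam hf.isRapid ha (norm_prod_sq z) p k
  rw [mderiv_zero] at h1
  have h2 := (hf.isFam_J0 hz).mderiv_eq (f := J0 z f)
    (fun t _ => (congrFun (hankelFam_J0 hz f) t).symm) p
  rw [gnorm_eq h2, gnorm_eq (Set.eqOn_refl (mderiv k f) _)]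
  simp only [add_comm (k _)]
  set I := ∫ t in Rpos d, (∏ l, t l ^ (p l + k l)) *
    ‖hankelFam (∏ l, (1 - z l)⁻¹) (scal z) f p t‖ ^ 2
  set I' := ∫ x in Rpos d, (∏ l, x l ^ (p l + k l)) * ‖mderiv k f x‖ ^ 2 with hI'
  have hI0 : 0 ≤ I' := setIntegral_nonneg measurableSet_Rpos fun x hx =>
    mul_nonneg (Finset.prod_nonneg fun l _ => pow_nonneg (hx l).le _) (sq_nonneg _)
  have hk : 0 < ∏ l, scal z l ^ k l := Finset.prod_pos fun l _ => pow_pos (ha l) _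
  have hI : I = (∏ l, scal z l ^ p l * (scal z l)⁻¹ ^ k l) * I' := by
    refine mul_left_cancel₀ hk.ne' (h1.trans ?_)
    rw [Finset.prod_mul_distrib]
    simp only [inv_pow, Finset.prod_inv_distrib]
    field_simp
  have hb : ∏ l, scal z l ^ p l * (scal z l)⁻¹ ^ k l ≤ (M ^ ∑ i, (p i + k i)) ^ 2 := by
    rw [← pow_mul, mul_comm, pow_mul, ← Finset.prod_pow_eq_pow_sum]
    refine Finset.prod_le_prod (fun l _ => ?_) fun l _ => ?_
    · exact mul_nonneg (pow_nonneg (ha l).le _) (pow_nonneg (inv_nonneg.2 (ha l).le) _)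
    · have h3 := inv_pos.2 (ha l)
      have h4 := hle l
      have h5 := ha l
      rw [pow_add]
      exact mul_le_mul (pow_le_pow_left₀ h5.le (by linarith) _)
        (pow_le_pow_left₀ h3.le (by linarith) _) (pow_nonneg h3.le _) (by positivity)
  calc Real.sqrt I ≤ Real.sqrt ((M ^ ∑ i, (p i + k i)) ^ 2 * I') :=
        Real.sqrt_le_sqrt (hI.le.trans (mul_le_mul_of_nonneg_right hb hI0))
    _ = M ^ (∑ i, (p i + k i)) * Real.sqrt I' := by
        rw [Real.sqrt_mul (sq_nonneg _), Real.sqrt_sq (by positivity)]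

end Spaces

/-- `J_{z,0}` maps `G_α` onto `G^α`, `G^β` onto `G_β` and `G_α^β` onto `G_β^α`, with
inverse `J_{z̄,0}`. -/
theorem stmt8 {d : ℕ} (α β : ℝ) (hα : 0 ≤ α) (hβ : 0 ≤ β)
    (z : Fin d → ℂ) (hz : ∀ l, ‖z l‖ = 1 ∧ z l ≠ 1) :
    (∀ f : (Fin d → ℝ) → ℂ, IsGlow α f →
      IsGupp α (J0 z f) ∧
      ∀ t ∈ Rpos d, J0 (fun l => starRingEnd ℂ (z l)) (J0 z f) t = f t) ∧
    (∀ f : (Fin d → ℝ) → ℂ, IsGupp β f →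
      IsGlow β (J0 z f) ∧
      ∀ t ∈ Rpos d, J0 (fun l => starRingEnd ℂ (z l)) (J0 z f) t = f t) ∧
    (∀ f : (Fin d → ℝ) → ℂ, IsGab α β f →
      IsGab β α (J0 z f) ∧
      ∀ t ∈ Rpos d, J0 (fun l => starRingEnd ℂ (z l)) (J0 z f) t = f t) := by
  obtain ⟨M, hM, hle⟩ := exists_gnorm_J0_le hz
  refine ⟨fun f hf => ⟨⟨hf.1.isSPlus_J0 hz, ?_⟩, J0_conj_J0 hf.1 hz⟩,
    fun f hf => ⟨⟨hf.1.isSPlus_J0 hz, ?_⟩, J0_conj_J0 hf.1 hz⟩,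
    fun f hf => ⟨⟨hf.1.isSPlus_J0 hz, ?_⟩, J0_conj_J0 hf.1 hz⟩⟩
  · obtain ⟨hS, A, hA, h⟩ := hf
    refine ⟨A * M, by positivity, fun k => ?_⟩
    obtain ⟨C, hC⟩ := h k
    refine ⟨M ^ (∑ i, k i) * C, fun p => ((hle f hS p k).trans
      (mul_le_mul_of_nonneg_left (hC p) (by positivity))).trans (le_of_eq ?_)⟩
    rw [Finset.sum_add_distrib, pow_add, mul_pow]
    ring
  · obtain ⟨hS, A, hA, h⟩ := hf
    refine ⟨A * M, by positivity, fun p => ?_⟩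
    obtain ⟨C, hC⟩ := h p
    refine ⟨M ^ (∑ i, p i) * C, fun k => ((hle f hS p k).trans
      (mul_le_mul_of_nonneg_left (hC k) (by positivity))).trans (le_of_eq ?_)⟩
    rw [Finset.sum_add_distrib, pow_add, mul_pow]
    ring
  · obtain ⟨hS, A, hA, C, hC0, hC⟩ := hf
    refine ⟨A * M, by positivity, C, hC0, fun p k => ((hle f hS p k).trans
      (mul_le_mul_of_nonneg_left (hC k p) (by positivity))).trans (le_of_eq ?_)⟩
    simp only [add_comm (k _)]
    rw [mul_pow]
    ring
end
end

section
/- Let d ∈ ℕ and let (a_n)_{n∈ℕ₀^d} be complex numbers. Define b_n = ∑_{k∈{0,1}^d, k ≤ n} (−1)^{|k|} a_{n−k} for n ∈ ℕ₀^d. Then for all n, m ∈ ℕ₀^d: ∑_{p ≤ m} b_{n+𝟏+p} = ∑_{k∈{0,1}^d} (−1)^{|k|} a_{n+m+𝟏−m^{(k)}}, where 𝟏 = (1,…,1), the sum on the left runs over all p ∈ ℕ₀^d with p_l ≤ m_l for all l, and m^{(k)} ∈ ℕ₀^d is defined by m^{(k)}_l = 0 if k_l = 0 and m^{(k)}_l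 = m_l + 1 if k_l = 1. -/
open Finset

/-- A sum over a dependent product indexed by `Fin (d + 1)` splits off its zeroth coordinate. -/
theorem sum_fin_cons {M : Type*} [AddCommMonoid M] {d : ℕ} {α : Fin (d + 1) → Type*}
    [∀ i, Fintype (α i)] (f : (∀ i, α i) → M) :
    ∑ p, f p = ∑ x : α 0, ∑ q : ∀ i : Fin d, α i.succ, f (Fin.cons x q) := by
  rw [← (Fin.consEquiv α).sum_comp, Fintype.sum_prod_type]
  rfl

/-- Summing the mixed backward difference of `a` over a box telescopes to the alternating sum of
`a` over the corners of the box. -/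
theorem sum_box_alternating_sum {R : Type*} [CommRing R] {d : ℕ} (a : (Fin d → ℕ) → R)
    (n m : Fin d → ℕ) :
    (∑ p : (∀ i : Fin d, Fin (m i + 1)), ∑ k : Fin d → Fin 2,
        (-1 : R) ^ (∑ l, (k l : ℕ)) * a (fun l => n l + 1 + (p l : ℕ) - (k l : ℕ)))
      = ∑ k : Fin d → Fin 2, (-1 : R) ^ (∑ l, (k l : ℕ)) *
          a (fun l => n l + m l + 1 - (if (k l : ℕ) = 0 then 0 else m l + 1)) := by
  induction d with
  | zero =>
    simp only [Finset.univ_eq_empty, Finset.sum_empty, Fintype.sum_unique]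
    exact congrArg (fun v => (-1 : R) ^ 0 * a v) (Subsingleton.elim _ _)
  | succ d ih =>
    set S : ℕ → R := fun x => ∑ k : Fin d → Fin 2, (-1 : R) ^ (∑ l, (k l : ℕ)) *
      a (Fin.cons x fun l => n l.succ + m l.succ + 1 -
        (if (k l : ℕ) = 0 then 0 else m l.succ + 1)) with hS
    have h_left (x : Fin (m 0 + 1)) (q : ∀ i : Fin d, Fin (m i.succ + 1)) (y : Fin 2)
        (k : Fin d → Fin 2) :
        (fun l : Fin (d + 1) => n l + 1 +
          ((Fin.cons (α := fun i => Fin (m i + 1)) x q l : Fin (m l + 1)) : ℕ) -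
          ((Fin.cons (α := fun _ => Fin 2) y k l : Fin 2) : ℕ))
        = (Fin.cons (n 0 + 1 + (x : ℕ) - (y : ℕ))
            (fun l => n l.succ + 1 + (q l : ℕ) - (k l : ℕ)) : Fin (d + 1) → ℕ) := by
      ext l
      cases l using Fin.cases <;> simp
    have h_right (y : Fin 2) (k : Fin d → Fin 2) :
        (fun l : Fin (d + 1) => n l + m l + 1 -
          (if ((Fin.cons (α := fun _ => Fin 2) y k l : Fin 2) : ℕ) = 0 then 0 else m l + 1))
        = (Fin.cons (n 0 + m 0 + 1 - (if (y : ℕ) = 0 then 0 else m 0 + 1))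
            (fun l => n l.succ + m l.succ + 1 -
              (if (k l : ℕ) = 0 then 0 else m l.succ + 1)) : Fin (d + 1) → ℕ) := by
      ext l
      cases l using Fin.cases <;> simp
    have h_telescope : ∑ x : Fin (m 0 + 1), (S (n 0 + 1 + x) - S (n 0 + x))
        = S (n 0 + m 0 + 1) - S (n 0) := by
      rw [Fin.sum_univ_eq_sum_range (fun x => S (n 0 + 1 + x) - S (n 0 + x))]
      simpa [add_assoc, add_comm, add_left_comm] using
        Finset.sum_range_sub (fun x => S (n 0 + x)) (m 0 + 1)
    calc
      _ = ∑ x : Fin (m 0 + 1), ∑ y : Fin 2, (-1 : R) ^ (y : ℕ) * S (n 0 + 1 + x - y) := by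
        rw [sum_fin_cons]
        refine Finset.sum_congr rfl fun x _ => ?_
        simp_rw [sum_fin_cons (α := fun _ : Fin (d + 1) => Fin 2), h_left]
        rw [Finset.sum_comm]
        refine Finset.sum_congr rfl fun y _ => ?_
        rw [hS]
        dsimp only
        rw [← ih (fun v => a (Fin.cons (n 0 + 1 + (x : ℕ) - (y : ℕ)) v))
          (fun l => n l.succ) (fun l => m l.succ)]
        simp only [Fin.sum_univ_succ (n := d), Fin.cons_zero, Fin.cons_succ, pow_add, mul_assoc,
          Finset.mul_sum]
      _ = S (n 0 + m 0 + 1) - S (n 0) := by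
        rw [← h_telescope]
        refine Finset.sum_congr rfl fun x _ => ?_
        have h_pred : n 0 + 1 + (x : ℕ) - 1 = n 0 + x := by omega
        simp [Fin.sum_univ_two, h_pred, sub_eq_add_neg]
      _ = ∑ y : Fin 2, (-1 : R) ^ (y : ℕ) *
            S (n 0 + m 0 + 1 - (if (y : ℕ) = 0 then 0 else m 0 + 1)) := by
        have h_cancel : n 0 + m 0 + 1 - (m 0 + 1) = n 0 := by omega
        simp [Fin.sum_univ_two, h_cancel, sub_eq_add_neg]
      _ = _ := by
        rw [sum_fin_cons]
        refine Finset.sum_congr rfl fun y _ => ?_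
        simp only [hS, h_right, Fin.sum_univ_succ (n := d), Fin.cons_zero, Fin.cons_succ, pow_add,
          mul_assoc, Finset.mul_sum]

/-- The telescoping identity: with `b_n = ∑_{k∈{0,1}^d, k≤n} (−1)^{|k|} a_{n−k}`, one has
`∑_{p ≤ m} b_{n+𝟏+p} = ∑_{k∈{0,1}^d} (−1)^{|k|} a_{n+m+𝟏−m^{(k)}}`, where `m^{(k)}_l = 0`
if `k_l = 0` and `m^{(k)}_l = m_l + 1` if `k_l = 1`. -/
theorem stmt11 {d : ℕ} (a b : (Fin d → ℕ) → ℂ)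
    (hb : ∀ n : Fin d → ℕ, b n =
      ∑ k : Fin d → Fin 2,
        if ∀ l, (k l : ℕ) ≤ n l then
          (-1 : ℂ) ^ (∑ l, (k l : ℕ)) * a (fun l => n l - (k l : ℕ))
        else 0)
    (n m : Fin d → ℕ) :
    (∑ p : (∀ i : Fin d, Fin (m i + 1)), b (fun l => n l + 1 + (p l : ℕ)))
      = ∑ k : Fin d → Fin 2, (-1 : ℂ) ^ (∑ l, (k l : ℕ)) *
          a (fun l => n l + m l + 1 - (if (k l : ℕ) = 0 then 0 else m l + 1)) := by
  rw [← sum_box_alternating_sum]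
  refine Finset.sum_congr rfl fun p _ => ?_
  rw [hb]
  refine Finset.sum_congr rfl fun k _ => if_pos fun l => ?_
  have := (k l).isLt
  omega
end

section
/- Let α ≥ 1, let (a_n)_{n∈ℕ₀^d} be complex numbers with a_n → 0 as |n| → ∞, and let F(w) = ∏_{j=1}^d (1−w_j) · ∑_{n∈ℕ₀^d} a_n w^n for w in the open unit polydisc D (the series converges absolutely on D and F is holomorphic on D). If there exist constants C, A > 0 such that |D^p F(w)| ≤ C A^{|p|} p^{αp} for all p ∈ ℕ₀^d and all w ∈ D, then there exist constants c > 0 and a > 1 such that |a_n| ≤ c a^{−|n|^{1/α}} for all n ∈ ℕ₀^d. -/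
open Filter Finset

noncomputable section

/-- The open unit polydisc. -/
def Dpoly (d : ℕ) : Set (Fin d → ℂ) := {w | ∀ l, ‖w l‖ < 1}

/-- Complex partial derivative in the `i`-th coordinate direction. -/
def pdC {d : ℕ} (i : Fin d) (F : (Fin d → ℂ) → ℂ) : (Fin d → ℂ) → ℂ :=
  fun w => fderiv ℂ F w (Pi.single i 1)

/-- Multi-index complex derivative `D^p F`. -/
def mderivC {d : ℕ} (p : Fin d → ℕ) (F : (Fin d → ℂ) → ℂ) : (Fin d → ℂ) → ℂ :=
  ((List.ofFn fun i : Fin d => (fun G => (pdC i)^[p i] G)).foldr (· ∘ ·) id) F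

/-- `F(w) = ∏(1−w_j) ∑_n a_n w^n`. -/
def Fser {d : ℕ} (a : (Fin d → ℕ) → ℂ) : (Fin d → ℂ) → ℂ :=
  fun w => (∏ j, (1 - w j)) * ∑' n : Fin d → ℕ, a n * ∏ l, w l ^ n l

/-- `G` is given on the open polydisc by the absolutely convergent power series with
coefficients `g`. -/
def HasPolydiscSeries {d : ℕ} (g : (Fin d → ℕ) → ℂ) (G : (Fin d → ℂ) → ℂ) : Prop :=
  (∀ r : ℝ, 0 < r → r < 1 → Summable fun k => ‖g k‖ * r ^ (∑ l, k l)) ∧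
    ∀ w ∈ Dpoly d, HasSum (fun k => g k * ∏ l, w l ^ k l) (G w)

lemma integral_fourier_haar (m : ℤ) :
    ∫ x : UnitAddCircle, fourier m x ∂AddCircle.haarAddCircle = if m = 0 then 1 else 0 := by
  have h := (orthonormal_iff_ite.mp (orthonormal_fourier (T := 1))) 0 m
  rw [fourierLp, fourierLp, MeasureTheory.ContinuousMap.inner_toLp] at h
  simpa [eq_comm] using h

lemma integral_prod_fourier {d : ℕ} (m : Fin d → ℤ) :
    ∫ x : Fin d → UnitAddCircle, ∏ l, fourier (m l) (x l)
      ∂MeasureTheory.Measure.pi (fun _ => AddCircle.haarAddCircle) = if m = 0 then 1 else 0 := by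
  rw [MeasureTheory.integral_fintype_prod_eq_prod (f := fun l x => (fourier (m l) x : ℂ))]
  simp_rw [integral_fourier_haar]
  split_ifs with h
  · simp [h]
  · obtain ⟨i, hi⟩ := Function.ne_iff.mp h
    exact Finset.prod_eq_zero (Finset.mem_univ i) (by simpa using hi)

lemma fourier_one_pow (k : ℕ) (x : UnitAddCircle) :
    (fourier 1 x : ℂ) ^ k = fourier (k : ℤ) x := by
  induction k with
  | zero => simp
  | succ k ih => rw [pow_succ, ih, Nat.cast_succ, fourier_add]

lemma HasPolydiscSeries.norm_coeff_mul_pow_le {d : ℕ} {g : (Fin d → ℕ) → ℂ}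
    {G : (Fin d → ℂ) → ℂ} (h : HasPolydiscSeries g G) {M : ℝ} (hM : ∀ w ∈ Dpoly d, ‖G w‖ ≤ M)
    (q : Fin d → ℕ) {r : ℝ} (hr0 : 0 < r) (hr1 : r < 1) : ‖g q‖ * r ^ (∑ l, q l) ≤ M := by
  set μ := MeasureTheory.Measure.pi
    (fun _ : Fin d => (AddCircle.haarAddCircle : MeasureTheory.Measure UnitAddCircle))
  let T : (Fin d → ℕ) → (Fin d → UnitAddCircle) → ℂ := fun k x =>
    (g k * r ^ (∑ l, k l)) * ∏ l, fourier ((k l : ℤ) - q l) (x l)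
  have hnorm : ∀ k x, ‖T k x‖ = ‖g k‖ * r ^ (∑ l, k l) := by
    intro k x
    simp [T, norm_prod, fourier_apply, abs_of_pos hr0, Circle.norm_coe]
  have hcont : ∀ k, Continuous (T k) := fun k => by fun_prop
  have hint : ∀ k, MeasureTheory.Integrable (T k) μ := fun k =>
    MeasureTheory.Integrable.of_bound (hcont k).aestronglyMeasurable (‖g k‖ * r ^ (∑ l, k l))
      (Filter.Eventually.of_forall fun x => (hnorm k x).le)
  have hsum := MeasureTheory.hasSum_integral_of_summable_integral_norm hint
    (by simpa [hnorm] using h.1 r hr0 hr1)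
  have hval : ∀ x, ‖∑' k, T k x‖ ≤ M := by
    intro x
    have hw : (fun l => (r : ℂ) * fourier 1 (x l)) ∈ Dpoly d := by
      intro l
      simpa [fourier_apply, abs_of_pos hr0, Circle.norm_coe] using hr1
    have h1 := (h.2 _ hw).mul_right (∏ l, fourier (-(q l : ℤ)) (x l))
    have h2 : HasSum (fun k => T k x)
        (G (fun l => (r : ℂ) * fourier 1 (x l)) * ∏ l, fourier (-(q l : ℤ)) (x l)) := by
      refine h1.congr_fun ?_
      intro k
      simp only [T, mul_pow, fourier_one_pow, Finset.prod_mul_distrib, Finset.prod_pow_eq_pow_sum,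
        sub_eq_add_neg, fourier_add]
      ring
    rw [h2.tsum_eq, norm_mul]
    have : ‖∏ l, (fourier (-(q l : ℤ)) (x l) : ℂ)‖ = 1 := by
      simp [norm_prod, fourier_apply, Circle.norm_coe]
    rw [this, mul_one]
    exact hM _ hw
  have hterm : ∀ k, ∫ x, T k x ∂μ = if k = q then g q * r ^ (∑ l, q l) else 0 := by
    intro k
    simp only [T, μ]
    rw [MeasureTheory.integral_const_mul, integral_prod_fourier (fun l => (k l : ℤ) - q l)]
    have : ((fun l => (k l : ℤ) - q l) = 0) ↔ k = q := by
      simp [funext_iff, sub_eq_zero]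
    simp only [this]
    by_cases hk : k = q <;> simp [hk]
  simp_rw [hterm] at hsum
  have heq := hsum.unique (hasSum_ite_eq q _)
  have hle := MeasureTheory.norm_integral_le_of_norm_le_const (μ := μ)
    (Filter.Eventually.of_forall hval)
  rw [heq] at hle
  simpa [abs_of_pos hr0] using hle

lemma HasPolydiscSeries.norm_coeff_le {d : ℕ} {g : (Fin d → ℕ) → ℂ}
    {G : (Fin d → ℂ) → ℂ} (h : HasPolydiscSeries g G) {M : ℝ} (hM : ∀ w ∈ Dpoly d, ‖G w‖ ≤ M)
    (q : Fin d → ℕ) : ‖g q‖ ≤ M := by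
  have hlim : Tendsto (fun r : ℝ => ‖g q‖ * r ^ (∑ l, q l)) (nhdsWithin 1 (Set.Iio 1))
      (nhds (‖g q‖ * 1 ^ (∑ l, q l))) :=
    (Continuous.tendsto (by fun_prop) 1).mono_left nhdsWithin_le_nhds
  rw [one_pow, mul_one] at hlim
  refine le_of_tendsto hlim ?_
  filter_upwards [Ioo_mem_nhdsLT (zero_lt_one' ℝ)] with r hr
  exact h.norm_coeff_mul_pow_le hM q hr.1 hr.2

lemma isOpen_setOf_forall_norm_lt {d : ℕ} (r : ℝ) : IsOpen {w : Fin d → ℂ | ∀ l, ‖w l‖ < r} := by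
  simp only [Set.ofPred_forall]
  exact isOpen_iInter_of_finite fun l => isOpen_lt (by fun_prop) continuous_const

lemma convex_setOf_forall_norm_lt {d : ℕ} (r : ℝ) :
    Convex ℝ {w : Fin d → ℂ | ∀ l, ‖w l‖ < r} := by
  intro x hx y hy a b ha hb hab l
  have := (convex_ball (0 : ℂ) r) (x := x l) (y := y l) (by simpa using hx l)
    (by simpa using hy l) ha hb hab
  simpa using this

lemma exists_lt_of_mem_Dpoly {d : ℕ} {w : Fin d → ℂ} (hw : w ∈ Dpoly d) :
    ∃ r : ℝ, 0 < r ∧ r < 1 ∧ ∀ l, ‖w l‖ < r := by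
  have h1 : ‖w‖ < 1 := (pi_norm_lt_iff one_pos).2 hw
  obtain ⟨r, hr, hr1⟩ := exists_between h1
  exact ⟨r, (norm_nonneg w).trans_lt hr, hr1, fun l => (norm_le_pi_norm w l).trans_lt hr⟩

lemma hasFDerivAt_monomial {d : ℕ} (k : Fin d → ℕ) (w : Fin d → ℂ) :
    HasFDerivAt (fun w : Fin d → ℂ => ∏ l, w l ^ k l)
      (∑ i, (∏ j ∈ Finset.univ.erase i, w j ^ k j) •
        (((k i : ℂ) * w i ^ (k i - 1)) •
          (ContinuousLinearMap.proj (R := ℂ) (φ := fun _ : Fin d => ℂ) i))) w := by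
  have := HasFDerivAt.finsetProd (𝕜 := ℂ) (u := Finset.univ)
    (g := fun (i : Fin d) (w : Fin d → ℂ) => w i ^ k i)
    (g' := fun i => ((k i : ℂ) * w i ^ (k i - 1)) •
          (ContinuousLinearMap.proj (R := ℂ) (φ := fun _ : Fin d => ℂ) i)) (x := w)
    (fun i _ => by
      simpa using (ContinuousLinearMap.proj (R := ℂ) (φ := fun _ : Fin d => ℂ) i).hasFDerivAt.pow
        (x := w) (k i))
  convert this using 1

lemma norm_fderiv_monomial_le {d : ℕ} (k : Fin d → ℕ) (w : Fin d → ℂ) {r : ℝ} (hr : 0 < r)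
    (hw : ∀ l, ‖w l‖ < r) :
    ‖∑ i, (∏ j ∈ Finset.univ.erase i, w j ^ k j) •
        (((k i : ℂ) * w i ^ (k i - 1)) •
          (ContinuousLinearMap.proj (R := ℂ) (φ := fun _ : Fin d => ℂ) i))‖
      ≤ (∑ l, k l : ℕ) * r ^ (∑ l, k l) / r := by
  have key : ∀ i : Fin d, ‖(∏ j ∈ Finset.univ.erase i, w j ^ k j) •
        (((k i : ℂ) * w i ^ (k i - 1)) •
          (ContinuousLinearMap.proj (R := ℂ) (φ := fun _ : Fin d => ℂ) i))‖
      ≤ (k i : ℝ) * (r ^ (∑ l, k l) / r) := by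
    intro i
    have hproj : ‖(ContinuousLinearMap.proj (R := ℂ) (φ := fun _ : Fin d => ℂ) i)‖ ≤ 1 :=
      ContinuousLinearMap.opNorm_le_bound _ zero_le_one fun v => by
        simpa using norm_le_pi_norm v i
    have h1 : ‖∏ j ∈ Finset.univ.erase i, w j ^ k j‖ ≤ ∏ j ∈ Finset.univ.erase i, r ^ k j := by
      rw [norm_prod]
      refine Finset.prod_le_prod (fun _ _ => norm_nonneg _) fun j _ => ?_
      rw [norm_pow]
      exact pow_le_pow_left₀ (norm_nonneg _) (hw j).le _
    have h2 : ‖(k i : ℂ) * w i ^ (k i - 1)‖ ≤ k i * (r ^ k i / r) := by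
      rw [norm_mul, norm_pow, Complex.norm_natCast]
      rcases Nat.eq_zero_or_pos (k i) with h | h
      · simp [h]
      · refine mul_le_mul_of_nonneg_left ?_ (Nat.cast_nonneg _)
        rw [← pow_sub_one_mul h.ne' r, mul_div_cancel_right₀ _ hr.ne']
        exact pow_le_pow_left₀ (norm_nonneg _) (hw i).le _
    rw [norm_smul, norm_smul]
    calc _ ≤ (∏ j ∈ Finset.univ.erase i, r ^ k j) * ((k i * (r ^ k i / r)) * 1) := by gcongr
      _ = _ := by
        rw [← Finset.prod_pow_eq_pow_sum, ← Finset.mul_prod_erase _ _ (Finset.mem_univ i)]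
        ring
  refine (norm_sum_le _ _).trans ((Finset.sum_le_sum fun i _ => key i).trans ?_)
  rw [← Finset.sum_mul, Nat.cast_sum, mul_div_assoc]

lemma HasPolydiscSeries.summable_degree_mul {d : ℕ} {g : (Fin d → ℕ) → ℂ}
    {G : (Fin d → ℂ) → ℂ} (h : HasPolydiscSeries g G) {r : ℝ} (hr0 : 0 < r) (hr1 : r < 1) :
    Summable fun k => ‖g k‖ * ((∑ l, k l : ℕ) * r ^ (∑ l, k l) / r) := by
  obtain ⟨ρ, hρ, hρ1⟩ := exists_between hr1
  have hρ0 := hr0.trans hρ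
  have hq : |r / ρ| < 1 := by
    rw [abs_of_pos (by positivity), div_lt_one hρ0]; exact hρ
  obtain ⟨B, hB⟩ : BddAbove (Set.range fun n : ℕ => (n : ℝ) * (r / ρ) ^ n) :=
    (tendsto_self_mul_const_pow_of_abs_lt_one hq).bddAbove_range
  refine Summable.of_nonneg_of_le (fun k => by positivity) (fun k => ?_)
    ((h.1 ρ hρ0 hρ1).mul_right (B / r))
  have hBk : ((∑ l, k l : ℕ) : ℝ) * (r / ρ) ^ (∑ l, k l) ≤ B := hB ⟨_, rfl⟩
  have : ((∑ l, k l : ℕ) : ℝ) * r ^ (∑ l, k l) ≤ B * ρ ^ (∑ l, k l) := by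
    rw [div_pow, mul_div_assoc', div_le_iff₀ (by positivity)] at hBk
    exact hBk
  calc _ ≤ ‖g k‖ * (B * ρ ^ (∑ l, k l) / r) := by gcongr
    _ = _ := by ring

lemma HasPolydiscSeries.hasSum_pdC {d : ℕ} {g : (Fin d → ℕ) → ℂ}
    {G : (Fin d → ℂ) → ℂ} (h : HasPolydiscSeries g G) {w : Fin d → ℂ} (hw : w ∈ Dpoly d)
    (i : Fin d) :
    HasSum (fun k => g k * ((∏ j ∈ Finset.univ.erase i, w j ^ k j) * (k i * w i ^ (k i - 1))))
      (pdC i G w) := by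
  obtain ⟨r, hr0, hr1, hwr⟩ := exists_lt_of_mem_Dpoly hw
  have hsub : {w : Fin d → ℂ | ∀ l, ‖w l‖ < r} ⊆ Dpoly d := fun z hz l => (hz l).trans hr1
  let f' : (Fin d → ℕ) → (Fin d → ℂ) → ((Fin d → ℂ) →L[ℂ] ℂ) := fun k w =>
    g k • ∑ i, (∏ j ∈ Finset.univ.erase i, w j ^ k j) • (((k i : ℂ) * w i ^ (k i - 1)) •
          (ContinuousLinearMap.proj (R := ℂ) (φ := fun _ : Fin d => ℂ) i))
  have hbd : ∀ k x, (∀ l, ‖x l‖ < r) →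
      ‖f' k x‖ ≤ ‖g k‖ * ((∑ l, k l : ℕ) * r ^ (∑ l, k l) / r) := fun k x hx => by
    simp only [f', norm_smul]
    exact mul_le_mul_of_nonneg_left (norm_fderiv_monomial_le k x hr0 hx) (norm_nonneg _)
  have hd := hasFDerivAt_tsum_of_isPreconnected (h.summable_degree_mul hr0 hr1)
    (isOpen_setOf_forall_norm_lt r) (convex_setOf_forall_norm_lt r).isPreconnected
    (f := fun k (w : Fin d → ℂ) => g k * ∏ l, w l ^ k l) (f' := f')
    (fun k x _ => (hasFDerivAt_monomial k x).const_smul (g k)) hbd hwr (h.2 w hw).summable hwr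
  have hG : HasFDerivAt G (∑' k, f' k w) w := by
    refine hd.congr_of_eventuallyEq ?_
    filter_upwards [(isOpen_setOf_forall_norm_lt r).mem_nhds hwr] with z hz
    exact (h.2 z (hsub hz)).tsum_eq.symm
  have hs : Summable fun k => f' k w :=
    Summable.of_norm_bounded (h.summable_degree_mul hr0 hr1) fun k => hbd k w hwr
  have := hs.hasSum.mapL (ContinuousLinearMap.apply ℂ ℂ (Pi.single i (1 : ℂ) : Fin d → ℂ))
  rw [pdC, hG.fderiv]
  refine this.congr_fun fun k => ?_
  simp [f', Pi.single_apply]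

lemma HasPolydiscSeries.shift_pdC {d : ℕ} {g : (Fin d → ℕ) → ℂ}
    {G : (Fin d → ℂ) → ℂ} (h : HasPolydiscSeries g G) (i : Fin d) :
    HasPolydiscSeries (fun k => (k i + 1) * g (k + Pi.single i 1)) (pdC i G) := by
  have hinj : Function.Injective fun k : Fin d → ℕ => k + Pi.single i 1 :=
    add_left_injective _
  have hdeg : ∀ k : Fin d → ℕ, ∑ l, (k + Pi.single i 1 : Fin d → ℕ) l = ∑ l, k l + 1 := fun k => by
    simp [Finset.sum_add_distrib]
  refine ⟨fun r hr0 hr1 => ?_, fun w hw => ?_⟩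
  · refine Summable.of_nonneg_of_le (fun k => by positivity) (fun k => ?_)
      ((h.summable_degree_mul hr0 hr1).comp_injective hinj)
    simp only [Function.comp_apply, hdeg, norm_mul]
    have h1 : ‖(k i : ℂ) + 1‖ ≤ ((∑ l, k l + 1 : ℕ) : ℝ) := by
      rw [← Nat.cast_succ, Complex.norm_natCast]
      exact_mod_cast Nat.succ_le_succ (Finset.single_le_sum (fun _ _ => Nat.zero_le _)
        (Finset.mem_univ i))
    calc _ ≤ ((∑ l, k l + 1 : ℕ) : ℝ) * ‖g (k + Pi.single i 1)‖ * r ^ (∑ l, k l) := by gcongr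
      _ = _ := by rw [pow_succ]; field_simp
  · have h1 := h.hasSum_pdC hw i
    rw [← hinj.hasSum_iff] at h1
    · refine h1.congr_fun ?_
      intro k
      have h2 : ∏ j ∈ Finset.univ.erase i, w j ^ (k + Pi.single i 1 : Fin d → ℕ) j
          = ∏ j ∈ Finset.univ.erase i, w j ^ k j :=
        Finset.prod_congr rfl fun j hj => by simp [Finset.ne_of_mem_erase hj]
      simp only [Function.comp_apply, h2]
      rw [← Finset.mul_prod_erase _ _ (Finset.mem_univ i)]
      simp
      ring
    · intro k hk
      have : k i = 0 := by
        by_contra h0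
        refine hk ⟨k - Pi.single i 1, ?_⟩
        funext l
        by_cases hl : l = i
        · subst hl; simp; omega
        · simp [hl]
      simp [this]

lemma prod_factorial_add_single {d : ℕ} (k : Fin d → ℕ) (i : Fin d) :
    ∏ l, ((k + Pi.single i 1 : Fin d → ℕ) l).factorial = (k i + 1) * ∏ l, (k l).factorial := by
  rw [← Finset.mul_prod_erase _ _ (Finset.mem_univ i),
    ← Finset.mul_prod_erase _ (fun l => (k l).factorial) (Finset.mem_univ i), ← mul_assoc]
  congr 1
  · simp [Nat.factorial_succ]
  · exact Finset.prod_congr rfl fun j hj => by simp [Finset.ne_of_mem_erase hj]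

lemma HasPolydiscSeries.pdC_div_factorial {d : ℕ} {h : (Fin d → ℕ) → ℂ} {G : (Fin d → ℂ) → ℂ}
    (hG : HasPolydiscSeries (fun k => h k / (∏ l, (k l).factorial : ℕ)) G) (i : Fin d) :
    HasPolydiscSeries (fun k => h (k + Pi.single i 1) / (∏ l, (k l).factorial : ℕ)) (pdC i G) := by
  convert hG.shift_pdC i using 2 with k
  rw [prod_factorial_add_single]
  have : ((k i : ℂ) + 1) ≠ 0 := Nat.cast_add_one_ne_zero _
  push_cast
  field_simp

lemma HasPolydiscSeries.iterate_pdC_div_factorial {d : ℕ} {h : (Fin d → ℕ) → ℂ}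
    {G : (Fin d → ℂ) → ℂ}
    (hG : HasPolydiscSeries (fun k => h k / (∏ l, (k l).factorial : ℕ)) G) (i : Fin d) (n : ℕ) :
    HasPolydiscSeries (fun k => h (k + Pi.single i n) / (∏ l, (k l).factorial : ℕ))
      ((pdC i)^[n] G) := by
  induction n with
  | zero => simpa using hG
  | succ n ih =>
    rw [Function.iterate_succ_apply']
    have := HasPolydiscSeries.pdC_div_factorial (h := fun k => h (k + (Pi.single i n : Fin d → ℕ)))
      (G := (pdC i)^[n] G) ih i
    convert this using 4 with k
    rw [add_assoc, ← Pi.single_add, add_comm 1 n]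

lemma HasPolydiscSeries.foldr_pdC_div_factorial {d : ℕ} {h : (Fin d → ℕ) → ℂ}
    {G : (Fin d → ℂ) → ℂ}
    (hG : HasPolydiscSeries (fun k => h k / (∏ l, (k l).factorial : ℕ)) G) (p : Fin d → ℕ)
    (L : List (Fin d)) :
    HasPolydiscSeries
      (fun k => h (k + (L.map fun i => (Pi.single i (p i) : Fin d → ℕ)).sum) /
        (∏ l, (k l).factorial : ℕ))
      (((L.map fun i => (fun G => (pdC i)^[p i] G)).foldr (· ∘ ·) id) G) := by
  induction L with
  | nil => simpa using hG
  | cons i L ih =>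
    have := HasPolydiscSeries.iterate_pdC_div_factorial
      (h := fun k => h (k + (L.map fun i => (Pi.single i (p i) : Fin d → ℕ)).sum)) ih i (p i)
    simpa only [List.map_cons, List.sum_cons, List.foldr_cons, Function.comp_apply,
      add_assoc] using this

lemma HasPolydiscSeries.mderivC_div_factorial {d : ℕ} {h : (Fin d → ℕ) → ℂ}
    {G : (Fin d → ℂ) → ℂ}
    (hG : HasPolydiscSeries (fun k => h k / (∏ l, (k l).factorial : ℕ)) G) (p : Fin d → ℕ) :
    HasPolydiscSeries (fun k => h (k + p) / (∏ l, (k l).factorial : ℕ)) (mderivC p G) := by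
  have := hG.foldr_pdC_div_factorial p (List.finRange d)
  rw [← List.ofFn_eq_map, ← List.ofFn_eq_map, List.sum_ofFn, Finset.univ_sum_single] at this
  exact this

/-- Cauchy's estimate for the Taylor coefficients of a mixed derivative. -/
lemma HasPolydiscSeries.norm_coeff_mul_descFactorial_le {d : ℕ} {g : (Fin d → ℕ) → ℂ}
    {G : (Fin d → ℂ) → ℂ} (hG : HasPolydiscSeries g G) {M : ℝ} {p q : Fin d → ℕ} (hpq : p ≤ q)
    (hM : ∀ w ∈ Dpoly d, ‖mderivC p G w‖ ≤ M) :
    ‖g q‖ * ∏ l, ((q l).descFactorial (p l) : ℝ) ≤ M := by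
  have hne : ∀ k : Fin d → ℕ, ((∏ l, (k l).factorial : ℕ) : ℂ) ≠ 0 := fun k =>
    Nat.cast_ne_zero.2 (Finset.prod_ne_zero_iff.2 fun l _ => Nat.factorial_ne_zero _)
  have h1 : HasPolydiscSeries
      (fun k => (g k * (∏ l, (k l).factorial : ℕ)) / (∏ l, (k l).factorial : ℕ)) G := by
    convert hG using 2 with k
    rw [mul_div_cancel_right₀ _ (hne k)]
  have h2 := (HasPolydiscSeries.mderivC_div_factorial
    (h := fun k => g k * (∏ l, (k l).factorial : ℕ)) h1 p).norm_coeff_le hM (q - p)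
  have h3 : (∏ l, (q l).factorial : ℕ)
      = (∏ l, ((q - p) l).factorial) * ∏ l, (q l).descFactorial (p l) := by
    rw [← Finset.prod_mul_distrib]
    exact Finset.prod_congr rfl fun l _ => (Nat.factorial_mul_descFactorial (hpq l)).symm
  simp only [tsub_add_cancel_of_le hpq] at h2
  rw [h3, Nat.cast_mul, mul_left_comm, mul_div_cancel_left₀ _ (hne _), norm_mul,
    Complex.norm_natCast, Nat.cast_prod] at h2
  exact h2

/-- The coefficients of `(1 - w i) * ∑ g_k w^k`. -/
def diffCoeff {d : ℕ} (i : Fin d) (g : (Fin d → ℕ) → ℂ) : (Fin d → ℕ) → ℂ :=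
  fun k => g k - Function.extend (fun k => k + Pi.single i 1) g 0 k

lemma diffCoeff_add_single {d : ℕ} (i : Fin d) (g : (Fin d → ℕ) → ℂ) (k : Fin d → ℕ) :
    diffCoeff i g (k + Pi.single i 1) = g (k + Pi.single i 1) - g k := by
  have := (add_left_injective (Pi.single i 1 : Fin d → ℕ)).extend_apply g 0 k
  rw [diffCoeff, this]

lemma tendsto_diffCoeff {d : ℕ} (i : Fin d) {g : (Fin d → ℕ) → ℂ}
    (hg : Tendsto g cofinite (nhds 0)) : Tendsto (diffCoeff i g) cofinite (nhds 0) := by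
  have hinj := add_left_injective (Pi.single i 1 : Fin d → ℕ)
  have h : Tendsto (Function.extend (fun k => k + Pi.single i 1) g 0) cofinite (nhds 0) := by
    rw [Metric.tendsto_nhds] at hg ⊢
    intro ε hε
    have := (hg ε hε)
    rw [Filter.eventually_cofinite] at this ⊢
    refine (this.image fun k => k + (Pi.single i 1 : Fin d → ℕ)).subset fun k hk => ?_
    by_cases h : ∃ m, m + (Pi.single i 1 : Fin d → ℕ) = k
    · obtain ⟨m, rfl⟩ := h
      refine ⟨m, ?_, rfl⟩
      simpa [hinj.extend_apply g 0 m] using hk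
    · exact absurd (by simpa [Function.extend_apply' _ _ _ h] using hε) hk
  simpa only [sub_zero] using! hg.sub h

lemma HasPolydiscSeries.one_sub_mul {d : ℕ} {g : (Fin d → ℕ) → ℂ}
    {G : (Fin d → ℂ) → ℂ} (hG : HasPolydiscSeries g G) (i : Fin d) :
    HasPolydiscSeries (diffCoeff i g) (fun w => (1 - w i) * G w) := by
  have hinj := add_left_injective (Pi.single i 1 : Fin d → ℕ)
  have hext := hinj.extend_apply g 0
  have hz : ∀ k ∉ Set.range (fun k : Fin d → ℕ => k + Pi.single i 1),
      Function.extend (fun k => k + Pi.single i 1) g 0 k = 0 := fun k hk =>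
    Function.extend_apply' _ _ _ hk
  have hdeg : ∀ k : Fin d → ℕ, ∑ l, (k + Pi.single i 1 : Fin d → ℕ) l = ∑ l, k l + 1 :=
    fun k => by simp [Finset.sum_add_distrib]
  refine ⟨fun r hr0 hr1 => ?_, fun w hw => ?_⟩
  · have h1 : Summable fun k =>
        ‖Function.extend (fun k => k + Pi.single i 1) g 0 k‖ * r ^ (∑ l, k l) := by
      rw [← hinj.summable_iff fun k hk => by simp [hz k hk]]
      refine ((hG.1 r hr0 hr1).mul_right r).congr fun k => ?_
      simp only [Function.comp_apply, hext, hdeg, pow_succ, mul_assoc]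
    refine Summable.of_nonneg_of_le (fun k => by positivity) (fun k => ?_)
      ((hG.1 r hr0 hr1).add h1)
    rw [← add_mul]
    exact mul_le_mul_of_nonneg_right (norm_sub_le _ _) (by positivity)
  · have h1 : HasSum (fun k => Function.extend (fun k => k + Pi.single i 1) g 0 k *
        ∏ l, w l ^ k l) (w i * G w) := by
      rw [← hinj.hasSum_iff fun k hk => by simp [hz k hk]]
      refine ((hG.2 w hw).mul_left (w i)).congr_fun fun k => ?_
      have h2 : ∏ l, w l ^ (k + Pi.single i 1 : Fin d → ℕ) l = w i * ∏ l, w l ^ k l := by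
        simp only [Pi.add_apply, pow_add, Finset.prod_mul_distrib]
        rw [mul_comm]
        simp [Pi.single_apply]
      simp only [Function.comp_apply, hext, h2]
      ring
    have := (hG.2 w hw).sub h1
    simp only [sub_mul, one_mul]
    refine this.congr_fun fun k => ?_
    rw [diffCoeff, sub_mul]

lemma summable_pow_sum {d : ℕ} {r : ℝ} (hr0 : 0 < r) (hr1 : r < 1) :
    Summable fun k : Fin d → ℕ => r ^ (∑ l, k l) := by
  refine summable_of_sum_le (c := ∏ _l : Fin d, (1 - r)⁻¹) (fun k => by positivity) fun s => ?_
  let N := s.sup (fun k => ∑ l, k l) + 1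
  have hs : s ⊆ Fintype.piFinset fun _ : Fin d => Finset.range N := fun k hk => by
    rw [Fintype.mem_piFinset]
    intro l
    rw [Finset.mem_range, Nat.lt_succ_iff]
    exact (Finset.single_le_sum (fun _ _ => Nat.zero_le _) (Finset.mem_univ l)).trans
      (Finset.le_sup (f := fun k : Fin d → ℕ => ∑ l, k l) hk)
  calc ∑ k ∈ s, r ^ (∑ l, k l)
      ≤ ∑ k ∈ Fintype.piFinset fun _ : Fin d => Finset.range N, r ^ (∑ l, k l) :=
        Finset.sum_le_sum_of_subset_of_nonneg hs fun _ _ _ => by positivity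
    _ = ∏ _l : Fin d, ∑ m ∈ Finset.range N, r ^ m := by
        rw [Finset.prod_univ_sum]
        simp [Finset.prod_pow_eq_pow_sum]
    _ ≤ _ := by
        refine Finset.prod_le_prod (fun _ _ => by positivity) fun _ _ => ?_
        rw [← tsum_geometric_of_lt_one hr0.le hr1]
        exact (summable_geometric_of_lt_one hr0.le hr1).sum_le_tsum _ fun _ _ => by positivity

lemma hasPolydiscSeries_of_tendsto {d : ℕ} {a : (Fin d → ℕ) → ℂ}
    (ha : Tendsto a cofinite (nhds 0)) :
    HasPolydiscSeries a (fun w => ∑' n : Fin d → ℕ, a n * ∏ l, w l ^ n l) := by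
  obtain ⟨B, hB⟩ : ∃ B, ∀ k, ‖a k‖ ≤ B := by
    obtain ⟨B, hB⟩ := ha.norm.bddAbove_range_of_cofinite
    exact ⟨B, fun k => hB ⟨k, rfl⟩⟩
  have hs : ∀ r : ℝ, 0 < r → r < 1 → Summable fun k => ‖a k‖ * r ^ (∑ l, k l) :=
    fun r hr0 hr1 => Summable.of_nonneg_of_le (fun k => by positivity)
      (fun k => mul_le_mul_of_nonneg_right (hB k) (by positivity))
      ((summable_pow_sum hr0 hr1).mul_left B)
  refine ⟨hs, fun w hw => ?_⟩
  obtain ⟨r, hr0, hr1, hwr⟩ := exists_lt_of_mem_Dpoly hw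
  refine (Summable.of_norm_bounded (hs r hr0 hr1) fun k => ?_).hasSum
  rw [norm_mul, norm_prod, ← Finset.prod_pow_eq_pow_sum]
  refine mul_le_mul_of_nonneg_left (Finset.prod_le_prod (fun _ _ => norm_nonneg _) fun l _ => ?_)
    (norm_nonneg _)
  rw [norm_pow]
  exact pow_le_pow_left₀ (norm_nonneg _) (hwr l).le _

lemma HasPolydiscSeries.list_prod_mul {d : ℕ} {g : (Fin d → ℕ) → ℂ}
    {G : (Fin d → ℂ) → ℂ} (hG : HasPolydiscSeries g G) (L : List (Fin d)) :
    HasPolydiscSeries (L.foldr diffCoeff g) (fun w => (L.map fun j => 1 - w j).prod * G w) := by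
  induction L with
  | nil => simpa using hG
  | cons i L ih => simpa [mul_assoc] using ih.one_sub_mul i

lemma hasPolydiscSeries_Fser {d : ℕ} {a : (Fin d → ℕ) → ℂ} (ha : Tendsto a cofinite (nhds 0)) :
    HasPolydiscSeries ((List.finRange d).foldr diffCoeff a) (Fser a) := by
  convert (hasPolydiscSeries_of_tendsto ha).list_prod_mul (List.finRange d) using 2 with w
  rw [← List.ofFn_eq_map, List.prod_ofFn, Fser]

/-- Stretched-exponential decay of order `β` in the total degree. -/
def StretchedExpDecay {d : ℕ} (β : ℝ) (g : (Fin d → ℕ) → ℂ) : Prop :=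
  ∃ K c : ℝ, 0 < c ∧ ∀ k, ‖g k‖ ≤ K * Real.exp (-(c * (∑ l, (k l : ℝ)) ^ β))

lemma summable_exp_neg_rpow {c β : ℝ} (hc : 0 < c) (hβ : 0 < β) :
    Summable fun m : ℕ => Real.exp (-(c * (m : ℝ) ^ β)) := by
  have h1 := (isLittleO_exp_neg_mul_rpow_atTop hc (-(2 / β))).comp_tendsto
    ((tendsto_rpow_atTop hβ).comp tendsto_natCast_atTop_atTop)
  refine summable_of_isBigO_nat (g := fun m : ℕ => ((m : ℝ) ^ (2 : ℕ))⁻¹)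
    (Real.summable_nat_pow_inv.2 (by norm_num)) (h1.isBigO.congr (fun m => ?_) fun m => ?_)
  · simp [neg_mul]
  · have : β * -(2 / β) = -2 := by field_simp
    simp only [Function.comp_apply]
    rw [← Real.rpow_mul (Nat.cast_nonneg _), this, Real.rpow_neg (Nat.cast_nonneg _)]
    norm_num

lemma StretchedExpDecay.of_diffCoeff {d : ℕ} {β : ℝ} (hβ : 0 < β) (i : Fin d)
    {g : (Fin d → ℕ) → ℂ} (hg : Tendsto g cofinite (nhds 0))
    (h : StretchedExpDecay β (diffCoeff i g)) : StretchedExpDecay β g := by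
  obtain ⟨K, c, hc, hK⟩ := h
  have hK0 : 0 ≤ K := by
    by_contra hneg
    have := (norm_nonneg _).trans (hK 0)
    have := mul_neg_of_neg_of_pos (not_le.1 hneg)
      (Real.exp_pos (-(c * (∑ l, ((0 : Fin d → ℕ) l : ℝ)) ^ β)))
    linarith
  have hS := summable_exp_neg_rpow (half_pos hc) hβ
  refine ⟨K * ∑' m : ℕ, Real.exp (-(c / 2 * (m : ℝ) ^ β)), c / 2, half_pos hc, fun k => ?_⟩
  set X : ℝ := ∑ l, (k l : ℝ) with hX
  have hX0 : 0 ≤ X := Finset.sum_nonneg fun _ _ => Nat.cast_nonneg _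
  have hstep : ∀ m : ℕ, ‖g (k + Pi.single i m) - g (k + Pi.single i (m + 1))‖
      ≤ K * Real.exp (-(c / 2 * X ^ β)) * Real.exp (-(c / 2 * (m : ℝ) ^ β)) := by
    intro m
    have h1 := hK (k + Pi.single i m + Pi.single i 1)
    rw [diffCoeff_add_single, add_assoc, ← Pi.single_add, norm_sub_rev] at h1
    refine h1.trans ?_
    rw [mul_assoc, ← Real.exp_add]
    refine mul_le_mul_of_nonneg_left (Real.exp_le_exp.2 ?_) hK0
    have hdeg : ∑ l, ((k + Pi.single i (m + 1) : Fin d → ℕ) l : ℝ) = X + (m + 1) := by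
      have : ∑ l, (k + Pi.single i (m + 1) : Fin d → ℕ) l = ∑ l, k l + (m + 1) := by
        simp [Finset.sum_add_distrib]
      rw [hX]
      exact_mod_cast this
    rw [hdeg]
    have h2 : X ^ β ≤ (X + (m + 1)) ^ β :=
      Real.rpow_le_rpow hX0 (le_add_of_nonneg_right (by positivity)) hβ.le
    have h3 : (m : ℝ) ^ β ≤ (X + (m + 1)) ^ β :=
      Real.rpow_le_rpow (Nat.cast_nonneg _) (by linarith) hβ.le
    nlinarith
  have hfin : ∀ N : ℕ, ‖g k‖ ≤ ‖g (k + Pi.single i N)‖ +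
      K * (∑' m : ℕ, Real.exp (-(c / 2 * (m : ℝ) ^ β))) * Real.exp (-(c / 2 * X ^ β)) := by
    intro N
    have h1 := Finset.sum_range_sub' (fun m => g (k + Pi.single i m)) N
    simp only [Pi.single_zero, add_zero] at h1
    have h2 : g k = g (k + Pi.single i N) +
        ∑ m ∈ Finset.range N, (g (k + Pi.single i m) - g (k + Pi.single i (m + 1))) := by
      rw [h1]; ring
    rw [h2]
    refine (norm_add_le _ _).trans (add_le_add le_rfl ?_)
    refine (norm_sum_le _ _).trans ((Finset.sum_le_sum fun m _ => hstep m).trans ?_)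
    rw [← Finset.mul_sum, mul_right_comm]
    exact mul_le_mul_of_nonneg_right
      (mul_le_mul_of_nonneg_left (hS.sum_le_tsum _ fun _ _ => (Real.exp_pos _).le) hK0)
      (Real.exp_pos _).le
  have hlim : Tendsto (fun N : ℕ => ‖g (k + Pi.single i N)‖) atTop (nhds 0) := by
    have hinj : Function.Injective fun N : ℕ => k + Pi.single i N :=
      (add_right_injective k).comp (Pi.single_injective i)
    have := (hg.comp hinj.tendsto_cofinite).norm
    rwa [Nat.cofinite_eq_atTop, norm_zero] at this
  have := ge_of_tendsto (hlim.add_const _) (Filter.Eventually.of_forall hfin)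
  simpa using this

lemma StretchedExpDecay.of_foldr_diffCoeff {d : ℕ} {β : ℝ} (hβ : 0 < β) (L : List (Fin d))
    {g : (Fin d → ℕ) → ℂ} (hg : Tendsto g cofinite (nhds 0))
    (h : StretchedExpDecay β (L.foldr diffCoeff g)) : StretchedExpDecay β g := by
  induction L with
  | nil => exact h
  | cons i L ih =>
    refine ih (StretchedExpDecay.of_diffCoeff hβ i ?_ h)
    clear ih h
    induction L with
    | nil => exact hg
    | cons j L ih => exact tendsto_diffCoeff j ih

/-- Optimising the order of differentiation in a Gevrey-type Cauchy estimate. -/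
lemma exists_order_pow_mul_rpow_le {α A : ℝ} (hα : 1 ≤ α) (hA : 0 < A) :
    ∃ c > (0 : ℝ), ∀ k : ℕ, ∃ p ≤ k,
      A ^ p * (p : ℝ) ^ (α * p) ≤
        Real.exp 1 * Real.exp (-(c * (k : ℝ) ^ (1 / α))) * (k.descFactorial p : ℝ) := by
  have hα0 : 0 < α := by linarith
  set B : ℝ := 2 * A * Real.exp 1 + 2 with hB
  have hB2 : 2 ≤ B := by rw [hB]; have := Real.exp_pos 1; nlinarith [mul_pos hA this]
  have hB0 : 0 < B := by linarith
  refine ⟨(B ^ (1 / α))⁻¹, by positivity, fun k => ?_⟩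
  set x : ℝ := (k / B) ^ (1 / α) with hx
  have hkB : (0 : ℝ) ≤ k / B := by positivity
  have hx0 : 0 ≤ x := by positivity
  have hxα : x ^ α = k / B := by
    rw [hx, ← Real.rpow_mul hkB, one_div_mul_cancel hα0.ne', Real.rpow_one]
  set p := ⌊x⌋₊ with hp
  have hpx : (p : ℝ) ≤ x := Nat.floor_le hx0
  have hxp : x < p + 1 := Nat.lt_floor_add_one x
  have h2p : 2 * (p : ℝ) ≤ k := by
    rcases Nat.eq_zero_or_pos p with h0 | h0
    · simp [h0]
    · have h1x : 1 ≤ x := le_trans (by exact_mod_cast h0) hpx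
      have : x ≤ k / B := by
        rw [← hxα]; exact Real.self_le_rpow_of_one_le h1x hα
      have h3 : (k : ℝ) / B ≤ k / 2 := by gcongr
      linarith
  have hpk : p ≤ k := by
    have : 2 * p ≤ k := by exact_mod_cast h2p
    omega
  refine ⟨p, hpk, ?_⟩
  have hdesc : ((k : ℝ) / 2) ^ p ≤ (k.descFactorial p : ℝ) := by
    have h1 : (((k + 1 - p) ^ p : ℕ) : ℝ) ≤ k.descFactorial p := by
      exact_mod_cast Nat.pow_sub_le_descFactorial k p
    refine le_trans ?_ h1
    rw [Nat.cast_pow, Nat.cast_sub (by omega)]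
    push_cast
    gcongr
    linarith
  have hbase : A * (p : ℝ) ^ α ≤ Real.exp (-1) * ((k : ℝ) / 2) := by
    have h1 : (p : ℝ) ^ α ≤ k / B := by
      rw [← hxα]; exact Real.rpow_le_rpow (Nat.cast_nonneg _) hpx hα0.le
    have h2 : A * (k / B) ≤ Real.exp (-1) * ((k : ℝ) / 2) := by
      rw [Real.exp_neg, mul_div_assoc', div_le_iff₀ hB0]
      have he := Real.exp_pos 1
      have : (Real.exp 1)⁻¹ * (k / 2) * B = A * k + (Real.exp 1)⁻¹ * k := by
        rw [hB]; field_simp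
      rw [this]
      have : 0 ≤ (Real.exp 1)⁻¹ * (k : ℝ) := by positivity
      linarith
    exact (mul_le_mul_of_nonneg_left h1 hA.le).trans h2
  have hexp : Real.exp (-1) ^ p ≤
      Real.exp 1 * Real.exp (-((B ^ (1 / α))⁻¹ * (k : ℝ) ^ (1 / α))) := by
    rw [← Real.exp_nat_mul, ← Real.exp_add]
    refine Real.exp_le_exp.2 ?_
    have : (B ^ (1 / α))⁻¹ * (k : ℝ) ^ (1 / α) = x := by
      rw [hx, Real.div_rpow (Nat.cast_nonneg _) hB0.le]; ring
    rw [this]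
    linarith
  calc A ^ p * (p : ℝ) ^ (α * p) = (A * (p : ℝ) ^ α) ^ p := by
        rw [mul_pow, Real.rpow_mul (Nat.cast_nonneg _), Real.rpow_natCast]
    _ ≤ (Real.exp (-1) * ((k : ℝ) / 2)) ^ p := by gcongr
    _ = Real.exp (-1) ^ p * ((k : ℝ) / 2) ^ p := mul_pow _ _ _
    _ ≤ _ := by gcongr

lemma sum_rpow_le_sum_rpow {ι : Type*} (s : Finset ι) (f : ι → ℝ) (hf : ∀ i, 0 ≤ f i) {β : ℝ}
    (hβ0 : 0 < β) (hβ1 : β ≤ 1) : (∑ i ∈ s, f i) ^ β ≤ ∑ i ∈ s, f i ^ β :=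
  Finset.le_sum_of_subadditive_on_pred (fun x : ℝ => x ^ β) (fun x => 0 ≤ x)
    (Real.zero_rpow hβ0.ne').le
    (fun _ _ hx hy => Real.rpow_add_le_add_rpow hx hy hβ0.le hβ1)
    (fun _ _ hx hy => add_nonneg hx hy) f (fun i _ => hf i)

lemma stretchedExpDecay_of_mul_descFactorial_le {d : ℕ} {α C A : ℝ} (hα : 1 ≤ α) (hC : 0 < C)
    (hA : 0 < A) {g : (Fin d → ℕ) → ℂ}
    (hg : ∀ p q : Fin d → ℕ, p ≤ q → ‖g q‖ * ∏ l, ((q l).descFactorial (p l) : ℝ) ≤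
      C * A ^ (∑ l, p l) * ∏ l, ((p l : ℝ)) ^ (α * (p l : ℝ))) :
    StretchedExpDecay (1 / α) g := by
  obtain ⟨c, hc, hord⟩ := exists_order_pow_mul_rpow_le hα hA
  have hα0 : 0 < α := by linarith
  refine ⟨C * ∏ _l : Fin d, Real.exp 1, c, hc, fun q => ?_⟩
  choose P hPle hP using hord
  have h1 := hg (fun l => P (q l)) q fun l => hPle _
  have hD : 0 < ∏ l, ((q l).descFactorial (P (q l)) : ℝ) :=
    Finset.prod_pos fun l _ => by exact_mod_cast Nat.descFactorial_pos.2 (hPle _)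
  refine le_of_mul_le_mul_right (h1.trans ?_) hD
  rw [mul_assoc, mul_assoc, mul_assoc]
  refine mul_le_mul_of_nonneg_left ?_ hC.le
  rw [← Finset.prod_pow_eq_pow_sum, ← Finset.prod_mul_distrib]
  calc _ ≤ ∏ l, (Real.exp 1 * Real.exp (-(c * (q l : ℝ) ^ (1 / α))) *
        ((q l).descFactorial (P (q l)) : ℝ)) :=
        Finset.prod_le_prod (fun l _ => by positivity) fun l _ => hP (q l)
    _ = (∏ _l : Fin d, Real.exp 1) * (Real.exp (-(c * ∑ l, (q l : ℝ) ^ (1 / α))) *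
        ∏ l, ((q l).descFactorial (P (q l)) : ℝ)) := by
        rw [Finset.prod_mul_distrib, Finset.prod_mul_distrib, Finset.mul_sum,
          ← Finset.sum_neg_distrib, Real.exp_sum, mul_assoc]
    _ ≤ _ := by
        have := sum_rpow_le_sum_rpow Finset.univ (fun l => (q l : ℝ))
          (fun _ => Nat.cast_nonneg _) (one_div_pos.2 hα0) ((div_le_one hα0).2 hα)
        gcongr

/-- For `α ≥ 1` and `a_n → 0`: if `|D^p F(w)| ≤ C A^{|p|} p^{αp}` on the polydisc, then
`|a_n| ≤ c a^{−|n|^{1/α}}` for some `c > 0`, `a > 1`. -/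
theorem stmt12 {d : ℕ} (α : ℝ) (hα : 1 ≤ α) (a : (Fin d → ℕ) → ℂ)
    (ha0 : Tendsto a cofinite (nhds 0))
    (C A : ℝ) (hC : 0 < C) (hA : 0 < A)
    (hbound : ∀ p : Fin d → ℕ, ∀ w ∈ Dpoly d,
      ‖mderivC p (Fser a) w‖ ≤
        C * A ^ (∑ l, p l) * ∏ l, ((p l : ℝ)) ^ (α * (p l : ℝ))) :
    ∃ c > (0:ℝ), ∃ b > (1:ℝ), ∀ n : Fin d → ℕ,
      ‖a n‖ ≤ c * b ^ (-((∑ l, (n l : ℝ)) ^ (1/α))) := by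
  have hF := hasPolydiscSeries_Fser ha0
  have hdecay := stretchedExpDecay_of_mul_descFactorial_le hα hC hA fun p q hpq =>
    hF.norm_coeff_mul_descFactorial_le hpq (hbound p)
  obtain ⟨K, c, hc, hK⟩ := hdecay.of_foldr_diffCoeff (by positivity) _ ha0
  refine ⟨max K 1, by positivity, Real.exp c, Real.one_lt_exp_iff.2 hc, fun n => ?_⟩
  rw [← Real.exp_mul, mul_neg]
  exact (hK n).trans (mul_le_mul_of_nonneg_right (le_max_left _ _) (Real.exp_pos _).le)
end
end
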